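/- For any β ∈ ℂ and any N×N complex matrices A and B, the Brezin–Gross–Witten partition function satisfies ∫_{U(N)} exp(β Tr(UA + U†B)) d_*U = Σ_{λ : ℓ(λ) ≤ N} β^{2|λ|} · s_λ(p_∞)² · s_λ(AB) / s_λ(I_N), the absolutely convergent sum over all partitions λ with at most N parts. -/

import Mathlib

open scoped BigOperators Classical
open MeasureTheory Matrix

noncomputable section

/-- Complete homogeneous symmetric functions of the eigenvalues of `X`, defined through
Newton's identities from the power sums `p_m = Tr(X^m)`. -/
def hMat {N : ℕ} (X : Matrix (Fin N) (Fin N) ℂ) : ℕ → ℂ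
  | 0 => 1
  | (k+1) => ((k : ℂ) + 1)⁻¹ *
      ∑ m ∈ Finset.range (k+1), (X ^ (m+1)).trace * hMat X (k - m)
  termination_by k => k
  decreasing_by exact Nat.lt_succ_of_le (Nat.sub_le _ _)

def hMatZ {N : ℕ} (X : Matrix (Fin N) (Fin N) ℂ) (k : ℤ) : ℂ :=
  if k < 0 then 0 else hMat X k.toNat

/-- The Schur polynomial `s_λ(X)` of an `N×N` complex matrix `X`, evaluated at the
eigenvalues of `X`, via the Jacobi-Trudi formula `s_λ = det(h_{λ_i - i + j})`.
Here `l : Fin N → ℕ` lists the (at most `N`) parts of the partition `λ`. -/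
def schur {N : ℕ} (l : Fin N → ℕ) (X : Matrix (Fin N) (Fin N) ℂ) : ℂ :=
  (Matrix.of fun i j : Fin N => hMatZ X ((l i : ℤ) - (i : ℤ) + (j : ℤ))).det

/-- Partitions with at most `N` parts (weakly decreasing functions `Fin N → ℕ`). -/
def PartitionN (N : ℕ) := {l : Fin N → ℕ // Antitone l}

/-- `1/k!` for `k : ℤ`, zero for negative `k`. -/
def factInvZ (k : ℤ) : ℂ := if k < 0 then 0 else ((Nat.factorial k.toNat : ℂ))⁻¹

/-- The specialization `s_λ(p_∞) = dim λ / |λ|!` of the Schur function at the power sums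
`p_1 = 1`, `p_k = 0` for `k ≥ 2`, via Jacobi-Trudi (`h_k(p_∞) = 1/k!`). -/
def schurPInf {N : ℕ} (l : Fin N → ℕ) : ℂ :=
  (Matrix.of fun i j : Fin N => factInvZ ((l i : ℤ) - (i : ℤ) + (j : ℤ))).det

/-- The weight `|λ| = Σ λ_i` of a partition. -/
def wt {N : ℕ} (l : Fin N → ℕ) : ℕ := ∑ i, l i

/-- The unitary group `U(N)`. -/
abbrev UN (N : ℕ) := Matrix.unitaryGroup (Fin N) ℂ

instance (N : ℕ) : MeasurableSpace (UN N) := borel _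

/-- A function of a matrix is entire if it is holomorphic along every holomorphic curve. -/
def Ent {N : ℕ} (f : Matrix (Fin N) (Fin N) ℂ → ℂ) : Prop :=
  ∀ γ : ℂ → Matrix (Fin N) (Fin N) ℂ, (∀ i j, Differentiable ℂ fun z => γ z i j) →
    Differentiable ℂ fun z => f (γ z)

section entire
variable {N : ℕ}

lemma Ent.mul {f g : Matrix (Fin N) (Fin N) ℂ → ℂ} (hf : Ent f) (hg : Ent g) :
    Ent fun X => f X * g X := fun γ h => (hf γ h).mul (hg γ h)

lemma Ent.const (c : ℂ) : Ent (N := N) fun _ => c := fun _ _ => differentiable_const c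

lemma Ent.coord (i j : Fin N) : Ent fun X => X i j := fun _ h => h i j

lemma Ent.sum {ι : Type*} (s : Finset ι) {f : ι → Matrix (Fin N) (Fin N) ℂ → ℂ}
    (hf : ∀ i ∈ s, Ent (f i)) : Ent fun X => ∑ i ∈ s, f i X :=
  fun γ h => Differentiable.fun_sum fun i hi => hf i hi γ h

lemma Ent.prod {ι : Type*} (s : Finset ι) {f : ι → Matrix (Fin N) (Fin N) ℂ → ℂ}
    (hf : ∀ i ∈ s, Ent (f i)) : Ent fun X => ∏ i ∈ s, f i X :=
  fun γ h => Differentiable.fun_finsetProd fun i hi => hf i hi γ h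

lemma Ent.pow {f : Matrix (Fin N) (Fin N) ℂ → ℂ} (hf : Ent f) (n : ℕ) :
    Ent fun X => f X ^ n := fun γ h => (hf γ h).pow n

lemma Ent.comp {f : Matrix (Fin N) (Fin N) ℂ → ℂ} (hf : Ent f)
    {φ : Matrix (Fin N) (Fin N) ℂ → Matrix (Fin N) (Fin N) ℂ}
    (hφ : ∀ i j, Ent fun X => φ X i j) : Ent fun X => f (φ X) :=
  fun γ h => hf (fun z => φ (γ z)) fun i j => hφ i j γ h

lemma Ent.mulLeft (A : Matrix (Fin N) (Fin N) ℂ) (i j : Fin N) : Ent fun X : Matrix (Fin N) (Fin N) ℂ => (A * X) i j := by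
  simp only [Matrix.mul_apply]
  exact Ent.sum _ fun k _ => (Ent.const _).mul (Ent.coord _ _)

lemma Ent.powEntry (n : ℕ) (i j : Fin N) : Ent fun X => (X ^ n) i j := by
  induction n generalizing i j with
  | zero => simpa using Ent.const _
  | succ n ih =>
    simp only [pow_succ, Matrix.mul_apply]
    exact Ent.sum _ fun k _ => (ih _ _).mul (Ent.coord _ _)

lemma Ent.trace {φ : Matrix (Fin N) (Fin N) ℂ → Matrix (Fin N) (Fin N) ℂ}
    (hφ : ∀ i j, Ent fun X => φ X i j) : Ent fun X => (φ X).trace :=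
  Ent.sum _ fun i _ => hφ i i

lemma Ent.det {n : ℕ} {φ : Matrix (Fin N) (Fin N) ℂ → Matrix (Fin n) (Fin n) ℂ}
    (hφ : ∀ i j, Ent fun X => φ X i j) : Ent fun X => (φ X).det := by
  simp only [Matrix.det_apply']
  exact Ent.sum _ fun σ _ => (Ent.const _).mul (Ent.prod _ fun i _ => hφ _ _)

lemma hMat_zero (X : Matrix (Fin N) (Fin N) ℂ) : hMat X 0 = 1 := by
  rw [hMat]

lemma hMat_succ (X : Matrix (Fin N) (Fin N) ℂ) (k : ℕ) : hMat X (k + 1) = ((k : ℂ) + 1)⁻¹ *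
    ∑ m ∈ Finset.range (k+1), (X ^ (m+1)).trace * hMat X (k - m) := by
  rw [hMat]

lemma Ent.hMat (k : ℕ) : Ent (N := N) fun X => hMat X k := by
  induction k using Nat.strong_induction_on with
  | _ k ih =>
    cases k with
    | zero => simpa [hMat_zero] using Ent.const 1
    | succ k =>
      simp only [hMat_succ]
      exact (Ent.const _).mul (Ent.sum _ fun m _ =>
        (Ent.trace fun i j => Ent.powEntry _ i j).mul (ih _ (by omega)))

lemma Ent.hMatZ (k : ℤ) : Ent (N := N) fun X => hMatZ X k := by
  unfold _root_.hMatZ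
  split_ifs
  · exact Ent.const 0
  · exact Ent.hMat _

lemma Ent.schur (l : Fin N → ℕ) : Ent fun X => schur l X := by
  unfold _root_.schur
  exact Ent.det fun i j => by simpa using Ent.hMatZ _

lemma eq_of_eq_on_real {f g : ℂ → ℂ} (hf : Differentiable ℂ f) (hg : Differentiable ℂ g)
    (h : ∀ x : ℝ, f x = g x) (z : ℂ) : f z = g z := by
  have hfa : AnalyticOnNhd ℂ f Set.univ := fun z _ => hf.analyticAt z
  have hga : AnalyticOnNhd ℂ g Set.univ := fun z _ => hg.analyticAt z
  refine hfa.eqOn_of_preconnected_of_frequently_eq hga isPreconnected_univ (Set.mem_univ 0) ?_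
    (Set.mem_univ z)
  have ht : Filter.Tendsto (fun x : ℝ => (x : ℂ)) (nhdsWithin 0 {0}ᶜ) (nhdsWithin 0 {0}ᶜ) := by
    refine tendsto_nhdsWithin_iff.2 ⟨?_, ?_⟩
    · exact (Complex.continuous_ofReal.tendsto' 0 0 (by simp)).mono_left nhdsWithin_le_nhds
    · filter_upwards [self_mem_nhdsWithin] with x hx
      simpa using hx
  exact ht.frequently (Filter.Eventually.frequently (Filter.Eventually.of_forall h))

lemma Ent.eq_of_hermitian {f g : Matrix (Fin N) (Fin N) ℂ → ℂ} (hf : Ent f) (hg : Ent g)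
    (h : ∀ X : Matrix (Fin N) (Fin N) ℂ, X.IsHermitian → f X = g X)
    (X : Matrix (Fin N) (Fin N) ℂ) : f X = g X := by
  obtain ⟨H, K, hHh, hKh, hX⟩ : ∃ H K : Matrix (Fin N) (Fin N) ℂ, Hᴴ = H ∧ Kᴴ = K ∧
      H + Complex.I • K = X := by
    refine ⟨(2 : ℂ)⁻¹ • (X + Xᴴ), (2 : ℂ)⁻¹ • (-Complex.I) • (X - Xᴴ), ?_, ?_, ?_⟩
    · simp [Matrix.conjTranspose_smul, Matrix.conjTranspose_add, add_comm]
    · simp [Matrix.conjTranspose_smul, Matrix.conjTranspose_sub, ← smul_neg]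
    · ext i j
      simp
      linear_combination (-1/2 * (X i j - (starRingEnd ℂ) (X j i))) * Complex.I_mul_I
  have hd : ∀ i j, Differentiable ℂ fun z : ℂ => (H + z • K) i j := by
    intro i j
    simp only [Matrix.add_apply, Matrix.smul_apply, smul_eq_mul]
    fun_prop
  have := eq_of_eq_on_real (hf _ hd) (hg _ hd) (fun x => h _ (by
    rw [Matrix.IsHermitian, Matrix.conjTranspose_add, Matrix.conjTranspose_smul, hHh, hKh]
    simp)) Complex.I
  simpa [hX] using this

lemma Ent.eq_of_diagonal {f g : Matrix (Fin N) (Fin N) ℂ → ℂ} (hf : Ent f) (hg : Ent g)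
    (hfc : ∀ V X : Matrix (Fin N) (Fin N) ℂ, Vᴴ * V = 1 → f (V * X * Vᴴ) = f X)
    (hgc : ∀ V X : Matrix (Fin N) (Fin N) ℂ, Vᴴ * V = 1 → g (V * X * Vᴴ) = g X)
    (h : ∀ d : Fin N → ℂ, f (diagonal d) = g (diagonal d))
    (X : Matrix (Fin N) (Fin N) ℂ) : f X = g X := by
  refine hf.eq_of_hermitian hg (fun X hX => ?_) X
  have := hX.spectral_theorem
  rw [Unitary.conjStarAlgAut_apply] at this
  rw [this]
  have hV : (hX.eigenvectorUnitary : Matrix (Fin N) (Fin N) ℂ)ᴴ * hX.eigenvectorUnitary = 1 :=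
    Unitary.star_mul_self_of_mem hX.eigenvectorUnitary.2
  exact (hfc _ _ hV).trans ((h _).trans (hgc _ _ hV).symm)

end entire

section unitaryTrick
variable {N : ℕ}

lemma eq_of_eq_on_imag {f g : ℂ → ℂ} (hf : Differentiable ℂ f) (hg : Differentiable ℂ g)
    (h : ∀ x : ℝ, f (x * Complex.I) = g (x * Complex.I)) (z : ℂ) : f z = g z := by
  have h1 : Differentiable ℂ fun z : ℂ => z * Complex.I := by fun_prop
  have := eq_of_eq_on_real (hf.comp h1) (hg.comp h1) h (-z * Complex.I)
  have e : (-z * Complex.I) * Complex.I = z := by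
    linear_combination (-z) * Complex.I_mul_I
  simpa only [Function.comp, e] using this

open scoped ComplexOrder in
lemma Ent.eq_of_unitary_of_det {f g : Matrix (Fin N) (Fin N) ℂ → ℂ} (hf : Ent f) (hg : Ent g)
    (h : ∀ W : Matrix (Fin N) (Fin N) ℂ, Wᴴ * W = 1 → f W = g W)
    (M : Matrix (Fin N) (Fin N) ℂ) (hM : M.det ≠ 0) : f M = g M := by
  have hP : (Mᴴ * M).PosDef :=
    Matrix.PosDef.conjTranspose_mul_self _ (Matrix.mulVec_injective_iff_isUnit.2
      ((Matrix.isUnit_iff_isUnit_det _).2 (isUnit_iff_ne_zero.2 hM)))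
  have hH := hP.isHermitian
  have hs := hH.spectral_theorem
  have hpos := hP.eigenvalues_pos
  rw [Unitary.conjStarAlgAut_apply] at hs
  set V : Matrix (Fin N) (Fin N) ℂ := hH.eigenvectorUnitary.1 with hVdef
  have hV : Vᴴ * V = 1 := Unitary.star_mul_self_of_mem hH.eigenvectorUnitary.2
  have hV' : V * Vᴴ = 1 := Unitary.mul_star_self_of_mem hH.eigenvectorUnitary.2
  set e := hH.eigenvalues with he
  set d : Fin N → ℝ := fun i => Real.sqrt (e i) with hd
  have hdpos : ∀ i, 0 < d i := fun i => Real.sqrt_pos.2 (hpos i)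
  set Di : Matrix (Fin N) (Fin N) ℂ := diagonal fun i => ((d i)⁻¹ : ℂ) with hDi
  set D : Matrix (Fin N) (Fin N) ℂ := diagonal fun i => (d i : ℂ) with hD
  have hDD : Di * D = 1 := by
    rw [hDi, hD, diagonal_mul_diagonal, ← diagonal_one]
    congr 1; ext i
    exact inv_mul_cancel₀ (by exact_mod_cast (hdpos i).ne')
  set W := M * V * Di with hW
  have hWu : Wᴴ * W = 1 := by
    have h1 : Vᴴ * (Mᴴ * M) * V = diagonal fun i => (e i : ℂ) := by
      rw [hs]
      have : Vᴴ * (V * diagonal (RCLike.ofReal ∘ e) * star V) * V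
          = (Vᴴ * V) * diagonal (RCLike.ofReal ∘ e) * (Vᴴ * V) := by
        rw [Matrix.star_eq_conjTranspose]; noncomm_ring
      rw [this, hV]; simp [Function.comp_def]
    have h2 : Wᴴ * W = Di * (Vᴴ * (Mᴴ * M) * V) * Di := by
      have : Diᴴ = Di := by
        rw [hDi, diagonal_conjTranspose]
        congr 1; ext i; simp
      rw [hW, conjTranspose_mul, conjTranspose_mul, this]; noncomm_ring
    rw [h2, h1, hDi, diagonal_mul_diagonal, diagonal_mul_diagonal, ← diagonal_one]
    congr 1; ext i
    have h3 : (e i : ℂ) = (d i : ℂ) * (d i : ℂ) := by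
      rw [← Complex.ofReal_mul, Real.mul_self_sqrt (hpos i).le]
    have h4 : (d i : ℂ) ≠ 0 := by exact_mod_cast (hdpos i).ne'
    rw [h3]; field_simp
  have hMW : M = W * D * Vᴴ := by
    have : W * D * Vᴴ = M * V * (Di * D) * Vᴴ := by rw [hW]; noncomm_ring
    rw [this, hDD, Matrix.mul_one, Matrix.mul_assoc, hV', Matrix.mul_one]
  set γ : ℂ → Matrix (Fin N) (Fin N) ℂ := fun z =>
    W * (diagonal fun i => Complex.exp (z * (Real.log (d i) : ℂ))) * Vᴴ with hγ
  have hγd : ∀ i j, Differentiable ℂ fun z => γ z i j := by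
    intro i j
    simp only [hγ, Matrix.mul_apply, diagonal_apply]
    refine Differentiable.fun_sum fun k _ => Differentiable.mul_const (Differentiable.fun_sum
      fun m _ => Differentiable.const_mul ?_ _) _
    split_ifs
    · fun_prop
    · fun_prop
  have key := eq_of_eq_on_imag (hf γ hγd) (hg γ hγd) (fun x => h _ (by
    rw [hγ]
    simp only [conjTranspose_mul, conjTranspose_conjTranspose, diagonal_conjTranspose]
    set Δ := diagonal fun i => Complex.exp (x * Complex.I * (Real.log (d i) : ℂ))
    set Δ' := diagonal (star fun i => Complex.exp (x * Complex.I * (Real.log (d i) : ℂ)))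
      with hΔ'
    have hΔ : Δ' * Δ = 1 := by
      rw [diagonal_mul_diagonal, ← diagonal_one]
      congr 1; ext i
      simp only [Pi.star_apply, Complex.star_def, ← Complex.exp_conj, ← Complex.exp_add]
      simp
    have : V * (Δ' * Wᴴ) * (W * Δ * Vᴴ) = V * (Δ' * (Wᴴ * W) * Δ) * Vᴴ := by noncomm_ring
    rw [this, hWu, Matrix.mul_one, hΔ, Matrix.mul_one, hV'])) 1
  have hγ1 : γ 1 = M := by
    rw [hMW, hγ, hD]
    simp only [one_mul]
    congr 3; ext i
    rw [← Complex.ofReal_exp, Real.exp_log (hdpos i)]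
  simpa only [hγ1] using key

lemma Ent.eq_of_unitary {f g : Matrix (Fin N) (Fin N) ℂ → ℂ} (hf : Ent f) (hg : Ent g)
    (h : ∀ W : Matrix (Fin N) (Fin N) ℂ, Wᴴ * W = 1 → f W = g W)
    (M : Matrix (Fin N) (Fin N) ℂ) : f M = g M := by
  have hd : ∀ i j, Differentiable ℂ fun z : ℂ => (M + z • (1 : Matrix (Fin N) (Fin N) ℂ)) i j := by
    intro i j
    simp only [Matrix.add_apply, Matrix.smul_apply, smul_eq_mul]
    fun_prop
  have hdense : Dense {z : ℂ | (M + z • (1 : Matrix (Fin N) (Fin N) ℂ)).det ≠ 0} := by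
    have hfin : {z : ℂ | (M + z • (1 : Matrix (Fin N) (Fin N) ℂ)).det = 0}.Finite := by
      refine ((-M).charpoly.roots.toFinset.finite_toSet).subset fun z hz => ?_
      simp only [Finset.mem_coe, Multiset.mem_toFinset]
      rw [Polynomial.mem_roots (Matrix.charpoly_monic _).ne_zero, Polynomial.IsRoot.def,
        Matrix.eval_charpoly]
      rw [← hz.out]
      congr 1
      ext i j
      simp [Matrix.scalar_apply, Matrix.smul_one_eq_diagonal, add_comm]
    exact hfin.countable.dense_compl ℂ
  have := Continuous.ext_on hdense (hf _ hd).continuous (hg _ hd).continuous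
    (fun z hz => hf.eq_of_unitary_of_det hg h _ hz)
  simpa using congrFun this 0

end unitaryTrick

/-- An entire function invariant under unitary conjugation. -/
structure ClassFn {N : ℕ} (f : Matrix (Fin N) (Fin N) ℂ → ℂ) : Prop where
  ent : Ent f
  conj : ∀ V X : Matrix (Fin N) (Fin N) ℂ, Vᴴ * V = 1 → f (V * X * Vᴴ) = f X

/-- The elementary symmetric functions of the eigenvalues of `X`. -/
def eMat {N : ℕ} (r : ℕ) (X : Matrix (Fin N) (Fin N) ℂ) : ℂ :=
  ∑ S ∈ (Finset.univ : Finset (Fin N)).powersetCard r,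
    (Matrix.of fun i j => if i ∈ S then X i j else (1 : Matrix (Fin N) (Fin N) ℂ) i j).det

section elementary
variable {N : ℕ}

lemma ClassFn.eq {f g : Matrix (Fin N) (Fin N) ℂ → ℂ} (hf : ClassFn f) (hg : ClassFn g)
    (h : ∀ d : Fin N → ℂ, f (diagonal d) = g (diagonal d)) : f = g :=
  funext (hf.ent.eq_of_diagonal hg.ent hf.conj hg.conj h)

lemma ClassFn.const (c : ℂ) : ClassFn (N := N) fun _ => c := ⟨Ent.const c, fun _ _ _ => rfl⟩

lemma ClassFn.mul {f g : Matrix (Fin N) (Fin N) ℂ → ℂ} (hf : ClassFn f) (hg : ClassFn g) :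
    ClassFn fun X => f X * g X :=
  ⟨hf.ent.mul hg.ent, fun V X h => by rw [hf.conj V X h, hg.conj V X h]⟩

lemma ClassFn.sum {ι : Type*} (s : Finset ι) {f : ι → Matrix (Fin N) (Fin N) ℂ → ℂ}
    (hf : ∀ i ∈ s, ClassFn (f i)) : ClassFn fun X => ∑ i ∈ s, f i X :=
  ⟨Ent.sum s fun i hi => (hf i hi).ent,
    fun V X h => Finset.sum_congr rfl fun i hi => (hf i hi).conj V X h⟩

lemma conj_pow_trace (V X : Matrix (Fin N) (Fin N) ℂ) (h : Vᴴ * V = 1) (m : ℕ) :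
    ((V * X * Vᴴ) ^ m).trace = (X ^ m).trace := by
  have h' : V * Vᴴ = 1 := mul_eq_one_comm.1 h
  have : (V * X * Vᴴ) ^ m = V * X ^ m * Vᴴ := by
    induction m with
    | zero => simp [h']
    | succ m ih =>
      rw [pow_succ, ih, pow_succ]
      have : V * X ^ m * Vᴴ * (V * X * Vᴴ) = V * X ^ m * (Vᴴ * V) * X * Vᴴ := by noncomm_ring
      rw [this, h, Matrix.mul_one, Matrix.mul_assoc V]
  rw [this, Matrix.trace_mul_comm, ← Matrix.mul_assoc, h, Matrix.one_mul]

lemma hMat_congr {X Y : Matrix (Fin N) (Fin N) ℂ}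
    (h : ∀ m, (X ^ (m+1)).trace = (Y ^ (m+1)).trace) (k : ℕ) : hMat X k = hMat Y k := by
  induction k using Nat.strong_induction_on with
  | _ k ih =>
    cases k with
    | zero => simp [hMat_zero]
    | succ k =>
      rw [hMat_succ, hMat_succ]
      congr 1
      refine Finset.sum_congr rfl fun m _ => ?_
      rw [h, ih _ (by omega)]

lemma hMatZ_congr {X Y : Matrix (Fin N) (Fin N) ℂ}
    (h : ∀ m, (X ^ (m+1)).trace = (Y ^ (m+1)).trace) (k : ℤ) : hMatZ X k = hMatZ Y k := by
  simp only [hMatZ, hMat_congr h]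

lemma schur_congr {X Y : Matrix (Fin N) (Fin N) ℂ}
    (h : ∀ m, (X ^ (m+1)).trace = (Y ^ (m+1)).trace) (l : Fin N → ℕ) : schur l X = schur l Y := by
  simp only [schur, hMatZ_congr h]

lemma schur_mul_comm (l : Fin N → ℕ) (X Y : Matrix (Fin N) (Fin N) ℂ) :
    schur l (X * Y) = schur l (Y * X) := by
  refine schur_congr (fun m => ?_) l
  have : (X * Y) ^ (m + 1) = X * (Y * X) ^ m * Y := by
    induction m with
    | zero => simp
    | succ m ih => rw [pow_succ, ih, pow_succ]; noncomm_ring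
  rw [this, Matrix.trace_mul_comm, ← Matrix.mul_assoc, ← pow_succ']

lemma ClassFn.hMat (k : ℕ) : ClassFn (N := N) fun X => hMat X k :=
  ⟨Ent.hMat k, fun V X h => hMat_congr (fun _ => conj_pow_trace V X h _) k⟩

lemma ClassFn.hMatZ (k : ℤ) : ClassFn (N := N) fun X => hMatZ X k :=
  ⟨Ent.hMatZ k, fun V X h => hMatZ_congr (fun _ => conj_pow_trace V X h _) k⟩

lemma det_add_rows (A B : Fin N → Fin N → ℂ) (t : Fin N → ℂ) :
    (Matrix.of fun i j => A i j + t i * B i j).det =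
      ∑ S : Finset (Fin N), (∏ i ∈ S, t i) *
        (Matrix.of fun i j => if i ∈ S then B i j else A i j).det := by
  have h := (Matrix.detRowAlternating (R := ℂ) (n := Fin N)).toMultilinearMap.map_add_univ
    (fun i => t i • B i) A
  have e1 : ((fun i => t i • B i) + A) =
      (Matrix.of fun i j => A i j + t i * B i j) := by
    ext i j; simp [add_comm]
  rw [e1] at h
  refine h.trans (Finset.sum_congr rfl fun S _ => ?_)
  have h2 := (Matrix.detRowAlternating (R := ℂ) (n := Fin N)).toMultilinearMap.map_piecewise_smul
    t (fun i => if i ∈ S then B i else A i) S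
  have e2 : (S.piecewise (fun i => t i • B i) A) =
      S.piecewise (fun i => t i • (if i ∈ S then B i else A i))
        (fun i => if i ∈ S then B i else A i) := by
    ext i j
    by_cases hi : i ∈ S <;> simp [hi]
  rw [e2]
  refine h2.trans ?_
  rw [smul_eq_mul]
  congr 1
  refine congrArg (fun Y : Matrix (Fin N) (Fin N) ℂ => Y.det) ?_
  ext i j
  by_cases hi : i ∈ S <;> simp [hi]

lemma sum_finset_by_card (f : Finset (Fin N) → ℂ) :
    ∑ S : Finset (Fin N), f S = ∑ r ∈ Finset.range (N + 1),
      ∑ S ∈ (Finset.univ : Finset (Fin N)).powersetCard r, f S := by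
  have := Finset.sum_powerset (Finset.univ : Finset (Fin N)) f
  simpa using this

lemma det_add_smul (A B : Matrix (Fin N) (Fin N) ℂ) (x : ℂ) :
    (A + x • B).det = ∑ r ∈ Finset.range (N + 1), x ^ r *
      ∑ S ∈ (Finset.univ : Finset (Fin N)).powersetCard r,
        (Matrix.of fun i j => if i ∈ S then B i j else A i j).det := by
  have h := det_add_rows A B (fun _ => x)
  have e : A + x • B = Matrix.of fun i j => A i j + x * B i j := by ext i j; simp
  rw [e, h, sum_finset_by_card]
  refine Finset.sum_congr rfl fun r _ => ?_
  rw [Finset.mul_sum]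
  refine Finset.sum_congr rfl fun S hS => ?_
  rw [Finset.prod_const, (Finset.mem_powersetCard.1 hS).2]

lemma det_one_add_smul (X : Matrix (Fin N) (Fin N) ℂ) (x : ℂ) :
    (1 + x • X).det = ∑ r ∈ Finset.range (N + 1), x ^ r * eMat r X :=
  det_add_smul 1 X x

lemma coeff_eq_of_eval_eq {n : ℕ} {a b : ℕ → ℂ}
    (h : ∀ x : ℂ, ∑ r ∈ Finset.range n, x ^ r * a r = ∑ r ∈ Finset.range n, x ^ r * b r)
    {r : ℕ} (hr : r < n) : a r = b r := by
  have hp : (∑ r ∈ Finset.range n, Polynomial.monomial r (a r)) =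
      ∑ r ∈ Finset.range n, Polynomial.monomial r (b r) := by
    refine Polynomial.funext fun x => ?_
    simpa [Polynomial.eval_finsetSum, mul_comm] using h x
  have := congrArg (fun p => Polynomial.coeff p r) hp
  simpa [Polynomial.finsetSum_coeff, Polynomial.coeff_monomial, hr] using this

lemma eMat_of_lt {r : ℕ} (h : N < r) (X : Matrix (Fin N) (Fin N) ℂ) : eMat r X = 0 := by
  rw [eMat, Finset.powersetCard_eq_empty.2 (by simpa using h), Finset.sum_empty]

lemma eMat_diagonal (r : ℕ) (d : Fin N → ℂ) : eMat r (diagonal d) =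
    ∑ S ∈ (Finset.univ : Finset (Fin N)).powersetCard r, ∏ i ∈ S, d i := by
  refine Finset.sum_congr rfl fun S _ => ?_
  have : (Matrix.of fun i j => if i ∈ S then diagonal d i j else
      (1 : Matrix (Fin N) (Fin N) ℂ) i j) = diagonal fun i => if i ∈ S then d i else 1 := by
    ext i j
    by_cases hij : i = j
    · subst hij; simp
    · simp [hij]
  rw [this, det_diagonal, Finset.prod_ite_mem, Finset.univ_inter]

lemma ClassFn.eMat (r : ℕ) : ClassFn (N := N) fun X => eMat r X := by
  refine ⟨?_, fun V X h => ?_⟩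
  · unfold _root_.eMat
    refine Ent.sum _ fun S _ => Ent.det fun i j => ?_
    simp only [Matrix.of_apply]
    split_ifs
    · exact Ent.coord _ _
    · exact Ent.const _
  · by_cases hr : N < r
    · simp only [eMat_of_lt hr]
    · refine coeff_eq_of_eval_eq (n := N + 1) (a := fun r => _root_.eMat r (V * X * Vᴴ))
        (b := fun r => _root_.eMat r X) (fun x => ?_) (by omega)
      rw [← det_one_add_smul, ← det_one_add_smul]
      have h' : V * Vᴴ = 1 := mul_eq_one_comm.1 h
      have e : 1 + x • (V * X * Vᴴ) = V * (1 + x • X) * Vᴴ := by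
        rw [Matrix.mul_add, Matrix.add_mul, Matrix.mul_one, h']; simp
      rw [e, det_mul, det_mul, mul_right_comm, ← det_mul, h', det_one, one_mul]

lemma ClassFn.trace : ClassFn (N := N) fun X => X.trace :=
  ⟨Ent.trace fun i j => Ent.coord i j, fun V X h => by simpa using conj_pow_trace V X h 1⟩

lemma eMat_one (X : Matrix (Fin N) (Fin N) ℂ) : eMat 1 X = X.trace := by
  refine congrFun ((ClassFn.eMat 1).eq ClassFn.trace fun d => ?_) X
  simp [eMat_diagonal, Finset.powersetCard_one]

lemma eMat_top (X : Matrix (Fin N) (Fin N) ℂ) : eMat N X = X.det := by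
  have : (Finset.univ : Finset (Fin N)).powersetCard N = {Finset.univ} := by
    have h := Finset.powersetCard_self (Finset.univ : Finset (Fin N))
    rwa [Finset.card_univ, Fintype.card_fin] at h
  rw [eMat, this]
  simp only [Finset.sum_singleton, Finset.mem_univ, if_true]
  rfl

lemma eMat_zero (X : Matrix (Fin N) (Fin N) ℂ) : eMat 0 X = 1 := by
  rw [eMat]
  simp only [Finset.powersetCard_zero, Finset.sum_singleton, Finset.notMem_empty, if_false]
  exact det_one

lemma eMat_one_unitary (hN : 1 ≤ N) (U : Matrix (Fin N) (Fin N) ℂ) (hU : Uᴴ * U = 1) :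
    eMat 1 U = U.det * eMat (N - 1) Uᴴ := by
  have key : ∀ x : ℂ, ∑ r ∈ Finset.range (N + 1), x ^ r * (U.det * eMat r Uᴴ) =
      ∑ r ∈ Finset.range (N + 1), x ^ r * ∑ S ∈ (Finset.univ : Finset (Fin N)).powersetCard r,
        (Matrix.of fun i j => if i ∈ S then (1 : Matrix (Fin N) (Fin N) ℂ) i j else U i j).det := by
    intro x
    rw [← det_add_smul U 1 x]
    have : U + x • 1 = (1 + x • Uᴴ) * U := by
      rw [Matrix.add_mul, Matrix.one_mul, Matrix.smul_mul, hU]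
    rw [this, det_mul, det_one_add_smul, Finset.sum_mul]
    exact Finset.sum_congr rfl fun r _ => by ring
  rw [coeff_eq_of_eval_eq (a := fun r => U.det * eMat r Uᴴ) key (r := N - 1) (by omega), eMat]
  refine Finset.sum_bij' (fun S _ => Sᶜ) (fun S _ => Sᶜ) ?_ ?_ ?_ ?_ ?_
  · intro S hS
    simp only [Finset.mem_powersetCard_univ] at hS ⊢
    rw [Finset.card_compl, hS, Fintype.card_fin]
  · intro S hS
    simp only [Finset.mem_powersetCard_univ] at hS ⊢
    rw [Finset.card_compl, hS, Fintype.card_fin]; omega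
  · intro S _; exact compl_compl S
  · intro S _; exact compl_compl S
  · intro S _
    congr 1
    ext i j
    by_cases hi : i ∈ S <;> simp [hi]

/-! ### The linear recurrence for the complete homogeneous functions -/

lemma trace_diagonal_pow (d : Fin N → ℂ) (m : ℕ) :
    ((diagonal d) ^ m).trace = ∑ i, d i ^ m := by
  rw [diagonal_pow, trace_diagonal]; rfl

lemma derivative_prod_one_sub (d : Fin N → ℂ) (s : Finset (Fin N)) :
    PowerSeries.derivative ℂ (∏ i ∈ s, (1 - PowerSeries.C (d i) * PowerSeries.X)) =
      -(PowerSeries.mk fun m => ∑ i ∈ s, d i ^ (m + 1)) *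
        ∏ i ∈ s, (1 - PowerSeries.C (d i) * PowerSeries.X) := by
  induction s using Finset.induction_on with
  | empty =>
    have : (PowerSeries.mk fun m => ∑ i ∈ (∅ : Finset (Fin N)), d i ^ (m + 1)) = 0 := by
      ext; simp
    rw [this]; simp
  | insert a s ha ih =>
    rw [Finset.prod_insert ha, Derivation.leibniz, ih]
    have e : (PowerSeries.mk fun m => ∑ i ∈ insert a s, d i ^ (m + 1)) =
        (PowerSeries.mk fun m => d a ^ (m + 1)) +
          PowerSeries.mk fun m => ∑ i ∈ s, d i ^ (m + 1) := by
      ext m; simp [Finset.sum_insert ha]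
    have e2 : (PowerSeries.mk fun m => d a ^ (m + 1)) * (1 - PowerSeries.C (d a) * PowerSeries.X)
        = PowerSeries.C (d a) := by
      ext m
      rw [mul_sub, mul_one, ← mul_assoc, map_sub]
      cases m with
      | zero => simp
      | succ m =>
        rw [PowerSeries.coeff_succ_mul_X, PowerSeries.coeff_mul_C]
        simp [pow_succ]
    have e3 : PowerSeries.derivative ℂ (1 - PowerSeries.C (d a) * PowerSeries.X) =
        - PowerSeries.C (d a) := by
      rw [map_sub, Derivation.leibniz]
      simp
    rw [e, e3, smul_eq_mul, smul_eq_mul]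
    linear_combination (∏ i ∈ s, (1 - PowerSeries.C (d i) * PowerSeries.X)) * e2

lemma hMat_series (d : Fin N → ℂ) :
    (PowerSeries.mk (hMat (diagonal d))) *
      ∏ i, (1 - PowerSeries.C (d i) * PowerSeries.X) = 1 := by
  have hH : PowerSeries.derivative ℂ (PowerSeries.mk (hMat (diagonal d))) =
      (PowerSeries.mk fun m => ∑ i, d i ^ (m + 1)) * PowerSeries.mk (hMat (diagonal d)) := by
    ext k
    rw [PowerSeries.coeff_derivative, PowerSeries.coeff_mk, hMat_succ, PowerSeries.coeff_mul,
      Finset.Nat.sum_antidiagonal_eq_sum_range_succ_mk]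
    have : ((k : ℂ) + 1) ≠ 0 := by exact_mod_cast Nat.succ_ne_zero k
    rw [mul_comm, ← mul_assoc, mul_inv_cancel₀ this, one_mul]
    refine Finset.sum_congr rfl fun m _ => ?_
    simp [trace_diagonal_pow]
  refine PowerSeries.derivative.ext ?_ ?_
  · rw [Derivation.leibniz, derivative_prod_one_sub, hH, smul_eq_mul, smul_eq_mul,
      Derivation.map_one_eq_zero]
    ring
  · rw [map_mul, map_prod]
    simp [hMat_zero]

lemma hMat_recurrence (X : Matrix (Fin N) (Fin N) ℂ) {m : ℕ} (hm : 1 ≤ m) :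
    ∑ k ∈ Finset.range (N + 1), (-1) ^ k * eMat k X * hMatZ X ((m : ℤ) - k) = 0 := by
  refine congrFun (ClassFn.eq (f := fun X => ∑ k ∈ Finset.range (N + 1),
    (-1) ^ k * eMat k X * hMatZ X ((m : ℤ) - k)) (ClassFn.sum _ fun k _ =>
    ((ClassFn.const _).mul (ClassFn.eMat k)).mul (ClassFn.hMatZ _)) (ClassFn.const 0)
    fun d => ?_) X
  have h := congrArg (PowerSeries.coeff m) (hMat_series d)
  rw [PowerSeries.coeff_one, if_neg (by omega)] at h
  have hD : ∏ i, (1 - PowerSeries.C (d i) * PowerSeries.X) = ∑ S : Finset (Fin N),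
      PowerSeries.C ((-1) ^ S.card * ∏ i ∈ S, d i) * PowerSeries.X ^ S.card := by
    have := Finset.prod_add (fun i => - (PowerSeries.C (d i) * PowerSeries.X)) (fun _ => 1)
      (Finset.univ : Finset (Fin N))
    simp only [Finset.prod_const_one, mul_one, Finset.powerset_univ] at this
    rw [show (∏ i, (1 - PowerSeries.C (d i) * PowerSeries.X)) =
      ∏ i, (-(PowerSeries.C (d i) * PowerSeries.X) + 1) from
      Finset.prod_congr rfl fun i _ => by ring, this]
    refine Finset.sum_congr rfl fun S _ => ?_
    rw [Finset.prod_neg, Finset.prod_mul_distrib, Finset.prod_const]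
    simp [mul_assoc]
  rw [hD, Finset.mul_sum, map_sum, sum_finset_by_card] at h
  rw [← h]
  refine Finset.sum_congr rfl fun k _ => ?_
  rw [eMat_diagonal, Finset.mul_sum, Finset.sum_mul]
  refine Finset.sum_congr rfl fun S hS => ?_
  rw [(Finset.mem_powersetCard.1 hS).2, mul_left_comm, PowerSeries.coeff_C_mul,
    PowerSeries.coeff_mul_X_pow', PowerSeries.coeff_mk, hMatZ]
  congr 1
  by_cases hk : k ≤ m
  · rw [if_neg (by omega), if_pos hk]
    congr 1; omega
  · rw [if_pos (by omega), if_neg hk]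

end elementary

/-- Add one box in each row belonging to `S`. -/
def addBoxes {N : ℕ} (l : Fin N → ℕ) (S : Finset (Fin N)) : Fin N → ℕ :=
  fun i => l i + if i ∈ S then 1 else 0

section pieri
variable {N : ℕ}

lemma telescope_sum (c : ℕ → ℂ) (x : ℂ) (l n : ℕ) :
    ∑ j ∈ Finset.range n, (c j + x * c (j + 1)) * (if l ≤ j then (-x) ^ (j - l) else 0) =
      if n ≤ l then 0 else c l - (-x) ^ (n - l) * c n := by
  induction n with
  | zero => simp
  | succ n ih =>
    rw [Finset.sum_range_succ, ih]
    rcases lt_trichotomy n l with h | h | h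
    · simp [h.le, Nat.succ_le_of_lt h, not_le.2 h]
    · subst h; simp
    · rw [if_pos h.le, if_neg (by omega), if_neg (by omega),
        show n + 1 - l = (n - l) + 1 by omega, pow_succ]
      ring

lemma det_schur_shift (l : Fin N → ℕ) (X : Matrix (Fin N) (Fin N) ℂ) (x : ℂ) :
    (Matrix.of fun i j : Fin N => hMatZ X ((l i : ℤ) - i + j) +
      x * hMatZ X ((l i : ℤ) - i + j + 1)).det =
      schur l X * ∑ r ∈ Finset.range (N + 1), x ^ r * eMat r X := by
  set B : Matrix (Fin N) (Fin N) ℂ := Matrix.of fun i j => hMatZ X ((l i : ℤ) - i + j) with hB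
  set R : Matrix (Fin N) (Fin N) ℂ :=
    Matrix.of fun j k => if (k : ℕ) ≤ j then (-x) ^ ((j : ℕ) - k) else 0 with hR
  have hRdet : R.det = 1 := by
    rw [Matrix.det_of_isLowerTriangular]
    · simp [hR]
    · intro i j hij
      have : i < j := hij
      simp only [hR, Matrix.of_apply]
      rw [if_neg (by simpa using this)]
  set w : Fin N → ℂ := fun j => (-1) ^ (N - (j : ℕ) + 1) * eMat (N - j) X with hw
  set z : Fin N → ℂ := fun j => -(-x) ^ (N - (j : ℕ)) with hz
  have hBw : ∀ i, ∑ j, B i j * w j = hMatZ X ((l i : ℤ) - i + N) := by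
    intro i
    have hrec := hMat_recurrence X (m := l i + N - i) (by omega)
    rw [Finset.sum_range_succ', ← Finset.sum_range_reflect] at hrec
    rw [← Fin.sum_univ_eq_sum_range (fun j => (-1) ^ (N - 1 - j + 1) * eMat (N - 1 - j + 1) X *
      hMatZ X (((l i + N - i : ℕ) : ℤ) - ((N - 1 - j + 1 : ℕ) : ℤ))) N] at hrec
    have h0 : (((l i + N - i : ℕ) : ℤ) - ((0 : ℕ) : ℤ)) = (l i : ℤ) - i + N := by omega
    rw [h0, eMat_zero, pow_zero, one_mul, one_mul] at hrec
    refine Eq.trans ?_ (neg_eq_of_add_eq_zero_right hrec)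
    rw [← Finset.sum_neg_distrib]
    refine Finset.sum_congr rfl fun j _ => ?_
    have h1 : N - 1 - (j : ℕ) + 1 = N - j := by omega
    have h2 : (((l i + N - i : ℕ) : ℤ) - ((N - j : ℕ) : ℤ)) = (l i : ℤ) - i + j := by omega
    rw [h1, h2, hw, hB]
    simp only [Matrix.of_apply, pow_succ]
    ring
  have hprod : (Matrix.of fun i j : Fin N => hMatZ X ((l i : ℤ) - i + j) +
      x * hMatZ X ((l i : ℤ) - i + j + 1)) * R =
      B * (1 + replicateCol Unit w * replicateRow Unit z) := by
    ext i k
    have ht := telescope_sum (fun j => hMatZ X ((l i : ℤ) - i + j)) x k N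
    rw [if_neg (by omega)] at ht
    rw [Matrix.mul_apply, Matrix.mul_add, Matrix.mul_one, Matrix.add_apply, ← Matrix.mul_assoc]
    have e1 : (B * replicateCol Unit w * replicateRow Unit z) i k =
        hMatZ X ((l i : ℤ) - i + N) * z k := by
      rw [← hBw i]
      simp [Matrix.mul_apply]
    rw [e1]
    rw [← Fin.sum_univ_eq_sum_range (fun j => (hMatZ X ((l i : ℤ) - i + j) +
      x * hMatZ X ((l i : ℤ) - i + ((j + 1 : ℕ) : ℤ))) *
        (if (k : ℕ) ≤ j then (-x) ^ (j - k) else 0)) N] at ht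
    refine Eq.trans (Finset.sum_congr rfl fun j _ => ?_) (ht.trans ?_)
    · simp only [hR, Matrix.of_apply]
      push_cast
      rw [add_assoc]
    · rw [hz, hB]; simp only [Matrix.of_apply]; ring
  have hd := congrArg Matrix.det hprod
  rw [det_mul, hRdet, mul_one, det_mul, det_one_add_replicateCol_mul_replicateRow] at hd
  rw [hd]
  have : schur l X = B.det := rfl
  rw [this]
  congr 1
  rw [Finset.sum_range_succ', ← Finset.sum_range_reflect, eMat_zero, pow_zero, one_mul, add_comm]
  congr 1
  rw [← Fin.sum_univ_eq_sum_range (fun j => x ^ (N - 1 - j + 1) * eMat (N - 1 - j + 1) X) N]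
  refine Finset.sum_congr rfl fun j _ => ?_
  have h1 : N - 1 - (j : ℕ) + 1 = N - j := by omega
  rw [h1, hz, hw]
  have h2 : ((-1 : ℂ)) ^ (N - (j : ℕ)) * (-1) ^ (N - (j : ℕ)) = 1 := by
    rw [← mul_pow]; simp
  simp only [neg_pow x, pow_succ]
  linear_combination (x ^ (N - (j : ℕ)) * eMat (N - j) X) * h2

lemma pieri (l : Fin N → ℕ) (r : ℕ) (X : Matrix (Fin N) (Fin N) ℂ) :
    ∑ S ∈ (Finset.univ : Finset (Fin N)).powersetCard r, schur (addBoxes l S) X =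
      eMat r X * schur l X := by
  by_cases hr : N < r
  · rw [eMat_of_lt hr, Finset.powersetCard_eq_empty.2 (by simpa using hr)]; simp
  refine coeff_eq_of_eval_eq (n := N + 1)
    (a := fun r => ∑ S ∈ (Finset.univ : Finset (Fin N)).powersetCard r, schur (addBoxes l S) X)
    (b := fun r => eMat r X * schur l X) (fun x => ?_) (by omega)
  have h := det_schur_shift l X x
  rw [det_add_rows (fun i j => hMatZ X ((l i : ℤ) - i + j))
    (fun i j => hMatZ X ((l i : ℤ) - i + j + 1)) fun _ => x, sum_finset_by_card, Finset.mul_sum] at h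
  refine Eq.trans ?_ (h.trans (Finset.sum_congr rfl fun r _ => by ring))
  refine Finset.sum_congr rfl fun r _ => ?_
  rw [Finset.mul_sum]
  refine Finset.sum_congr rfl fun S hS => ?_
  rw [Finset.prod_const, (Finset.mem_powersetCard.1 hS).2, schur]
  congr 3
  ext i j
  simp only [addBoxes]
  by_cases hi : i ∈ S
  · simp only [hi, if_true]
    congr 1; push_cast; ring
  · simp [hi]

lemma schur_zero (X : Matrix (Fin N) (Fin N) ℂ) : schur (fun _ => 0) X = 1 := by
  rw [schur, Matrix.det_of_isUpperTriangular]
  · refine Finset.prod_eq_one fun i _ => ?_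
    simp [hMatZ, hMat_zero]
  · intro i j hij
    have : j < i := hij
    simp only [Matrix.of_apply, hMatZ]
    rw [if_pos]
    have : (j : ℕ) < i := this
    push_cast; omega

lemma schur_eq_zero_of_succ {l : Fin N → ℕ} {i j : Fin N} (hij : (i : ℕ) + 1 = j)
    (h : l j = l i + 1) (X : Matrix (Fin N) (Fin N) ℂ) : schur l X = 0 := by
  refine Matrix.det_zero_of_row_eq (i := i) (j := j) (by rintro rfl; omega) ?_
  ext k
  simp only [Matrix.of_apply]
  congr 1; omega

lemma antitone_of_succ {l : Fin N → ℕ} (h : ∀ i j : Fin N, (i : ℕ) + 1 = j → l j ≤ l i) :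
    Antitone l := by
  cases N with
  | zero => exact fun i => i.elim0
  | succ n => exact Fin.antitone_iff_succ_le.2 fun i => h _ _ (by simp)

lemma schur_addBoxes_eq_zero {l : Fin N → ℕ} (hl : Antitone l) {S : Finset (Fin N)}
    (h : ¬ Antitone (addBoxes l S)) (X : Matrix (Fin N) (Fin N) ℂ) :
    schur (addBoxes l S) X = 0 := by
  have : ∃ i j : Fin N, (i : ℕ) + 1 = j ∧ addBoxes l S i < addBoxes l S j := by
    by_contra hc
    push Not at hc
    exact h (antitone_of_succ hc)
  obtain ⟨i, j, hij, hlt⟩ := this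
  refine schur_eq_zero_of_succ hij ?_ X
  have h1 : l j ≤ l i := hl (Fin.le_def.2 (by omega))
  unfold addBoxes at hlt ⊢
  split_ifs at hlt ⊢ <;> omega

end pieri

/-- The partitions of `n` with at most `N` parts. -/
def parts (N n : ℕ) : Finset (Fin N → ℕ) :=
  (Finset.piAntidiag Finset.univ n).filter Antitone

/-- Remove a box from row `i`. -/
def remBox {N : ℕ} (l : Fin N → ℕ) (i : Fin N) : Fin N → ℕ :=
  fun k => l k - if k = i then 1 else 0

section expansion
variable {N : ℕ}

lemma mem_parts {n : ℕ} {l : Fin N → ℕ} : l ∈ parts N n ↔ Antitone l ∧ wt l = n := by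
  simp [parts, Finset.mem_piAntidiag, wt, and_comm]

lemma sum_det_updateRow (A : Matrix (Fin N) (Fin N) ℂ) (c : Fin N → ℂ) :
    ∑ i, (A.updateRow i fun j => c j * A i j).det = (∑ j, c j) * A.det := by
  simp only [Matrix.det_apply']
  rw [Finset.sum_comm, Finset.mul_sum]
  refine Finset.sum_congr rfl fun σ _ => ?_
  have h : ∀ i, ∏ k, (A.updateRow i fun j => c j * A i j) (σ k) k =
      c (σ⁻¹ i) * ∏ k, A (σ k) k := by
    intro i
    have : ∀ k, (A.updateRow i fun j => c j * A i j) (σ k) k =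
        (if k = σ⁻¹ i then c k else 1) * A (σ k) k := by
      intro k
      by_cases hk : σ k = i
      · subst hk; simp
      · rw [Matrix.updateRow_ne hk, if_neg, one_mul]
        rintro rfl; simp at hk
    rw [Finset.prod_congr rfl fun k _ => this k, Finset.prod_mul_distrib]
    simp
  simp only [h]
  rw [← Finset.mul_sum, ← Finset.sum_mul, Equiv.sum_comp σ⁻¹ c]
  ring

lemma mul_factInvZ (k : ℤ) : (k : ℂ) * factInvZ k = factInvZ (k - 1) := by
  unfold factInvZ
  rcases lt_trichotomy k 0 with h | h | h
  · rw [if_pos h, if_pos (by omega), mul_zero]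
  · subst h; simp
  · rw [if_neg (by omega), if_neg (by omega)]
    obtain ⟨m, rfl⟩ : ∃ m : ℕ, k = m + 1 := ⟨(k - 1).toNat, by omega⟩
    have h1 : ((m : ℤ) + 1).toNat = m + 1 := by omega
    have h2 : ((m : ℤ) + 1 - 1).toNat = m := by omega
    rw [h1, h2, Nat.factorial_succ]
    have h3 : ((m : ℂ) + 1) ≠ 0 := by exact_mod_cast Nat.succ_ne_zero m
    have h4 : (m.factorial : ℂ) ≠ 0 := by exact_mod_cast m.factorial_ne_zero
    push_cast
    field_simp

lemma sum_schurPInf_lower (l : Fin N → ℕ) :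
    ∑ k, (Matrix.of fun i j : Fin N =>
      factInvZ ((l i : ℤ) - (if i = k then 1 else 0) - (i : ℤ) + (j : ℤ))).det =
      (wt l : ℂ) * schurPInf l := by
  set A : Matrix (Fin N) (Fin N) ℂ := Matrix.of fun i j : Fin N =>
    factInvZ ((l i : ℤ) - (i : ℤ) + (j : ℤ)) with hA
  have h : ∀ k, (Matrix.of fun i j : Fin N =>
      factInvZ ((l i : ℤ) - (if i = k then 1 else 0) - (i : ℤ) + (j : ℤ))).det =
      ((l k : ℂ) - k) * A.det + (A.updateRow k fun j => (j : ℂ) * A k j).det := by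
    intro k
    have e : (Matrix.of fun i j : Fin N =>
      factInvZ ((l i : ℤ) - (if i = k then 1 else 0) - (i : ℤ) + (j : ℤ))) =
      A.updateRow k (((l k : ℂ) - k) • A k + fun j : Fin N => (j : ℂ) * A k j) := by
      ext i j
      by_cases hi : i = k
      · subst hi
        rw [Matrix.updateRow_self]
        simp only [Matrix.of_apply, if_true, Pi.add_apply, Pi.smul_apply, smul_eq_mul, hA]
        rw [show (l i : ℤ) - 1 - i + j = (l i : ℤ) - i + j - 1 by ring, ← mul_factInvZ]
        push_cast; ring
      · rw [Matrix.updateRow_ne hi]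
        simp [hi, hA]
    rw [e, Matrix.det_updateRow_add, Matrix.det_updateRow_smul, Matrix.updateRow_eq_self]
  rw [Finset.sum_congr rfl fun k _ => h k, Finset.sum_add_distrib,
    sum_det_updateRow A fun j => (j : ℂ), ← Finset.sum_mul, Finset.sum_sub_distrib, wt]
  have : schurPInf l = A.det := rfl
  rw [this]; push_cast; ring

lemma lower_eq_schurPInf {l : Fin N → ℕ} (hl : Antitone l) (k : Fin N) :
    (Matrix.of fun i j : Fin N =>
      factInvZ ((l i : ℤ) - (if i = k then 1 else 0) - (i : ℤ) + (j : ℤ))).det =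
      if 1 ≤ l k ∧ Antitone (remBox l k) then schurPInf (remBox l k) else 0 := by
  split_ifs with h
  · rw [schurPInf]
    congr 2
    ext i j
    simp only [remBox]
    congr 1
    by_cases hi : i = k
    · subst hi; simp only [if_true]; omega
    · simp [hi]
  · by_cases hk : (k : ℕ) + 1 < N
    · have hkk : l ⟨k + 1, hk⟩ = l k := by
        by_contra hne
        have hlt : l ⟨k + 1, hk⟩ < l k :=
          lt_of_le_of_ne (hl (Fin.le_def.2 (by simp))) hne
        refine h ⟨by omega, antitone_of_succ fun i j hij => ?_⟩
        have hij' : l j ≤ l i := hl (Fin.le_def.2 (by omega))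
        unfold remBox
        by_cases hi : i = k
        · subst hi
          have : j = ⟨i + 1, hk⟩ := Fin.ext hij.symm
          subst this
          rw [if_pos rfl]; omega
        · rw [if_neg hi]; omega
      refine Matrix.det_zero_of_row_eq (i := k) (j := ⟨k + 1, hk⟩)
        (fun he => by simpa using congrArg Fin.val he) ?_
      ext j
      simp only [Matrix.of_apply, if_true]
      rw [if_neg (fun he => by simpa using congrArg Fin.val he), hkk]
      congr 1; push_cast; ring
    · have hk0 : l k = 0 := by
        by_contra hne
        refine h ⟨by omega, antitone_of_succ fun i j hij => ?_⟩
        have hij' : l j ≤ l i := hl (Fin.le_def.2 (by omega))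
        unfold remBox
        have : i ≠ k := by rintro rfl; omega
        rw [if_neg this]; omega
      refine Matrix.det_eq_zero_of_row_eq_zero k fun j => ?_
      simp only [Matrix.of_apply, if_true, hk0, factInvZ]
      rw [if_pos]
      omega

lemma sum_addBoxes_singleton (l : Fin N → ℕ) (X : Matrix (Fin N) (Fin N) ℂ) :
    ∑ i, schur (addBoxes l {i}) X = X.trace * schur l X := by
  rw [← eMat_one, ← pieri, Finset.powersetCard_one, Finset.sum_map]
  rfl

lemma wt_addBoxes (l : Fin N → ℕ) (S : Finset (Fin N)) : wt (addBoxes l S) = wt l + S.card := by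
  simp [wt, addBoxes, Finset.sum_add_distrib]

lemma remBox_addBoxes (l : Fin N → ℕ) (i : Fin N) : remBox (addBoxes l {i}) i = l := by
  ext k
  by_cases h : k = i <;> simp [remBox, addBoxes, h]

lemma addBoxes_remBox {l : Fin N → ℕ} {i : Fin N} (h : 1 ≤ l i) :
    addBoxes (remBox l i) {i} = l := by
  ext k
  by_cases hk : k = i
  · subst hk; simp [remBox, addBoxes]; omega
  · simp [remBox, addBoxes, hk]

lemma trace_pow_expansion (n : ℕ) (X : Matrix (Fin N) (Fin N) ℂ) :
    X.trace ^ n = (n.factorial : ℂ) * ∑ l ∈ parts N n, schurPInf l * schur l X := by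
  induction n with
  | zero =>
    have : parts N 0 = {fun _ => 0} := by
      ext l
      simp only [mem_parts, wt, Finset.sum_eq_zero_iff, Finset.mem_univ, true_implies,
        Finset.mem_singleton]
      exact ⟨fun h => funext h.2, by rintro rfl; exact ⟨antitone_const, fun _ => rfl⟩⟩
    rw [this, Finset.sum_singleton, schur_zero]
    have : schurPInf (fun _ : Fin N => 0) = 1 := by
      rw [schurPInf, Matrix.det_of_isUpperTriangular]
      · refine Finset.prod_eq_one fun i _ => ?_
        simp [factInvZ]
      · intro i j hij
        have : j < i := hij
        simp only [Matrix.of_apply, factInvZ]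
        rw [if_pos]
        have : (j : ℕ) < i := this
        push_cast; omega
    rw [this]; simp
  | succ n ih =>
    rw [pow_succ, ih, Nat.factorial_succ]
    push_cast
    have key : (∑ l ∈ parts N n, schurPInf l * schur l X) * X.trace =
        ((n : ℂ) + 1) * ∑ l ∈ parts N (n + 1), schurPInf l * schur l X := by
      have h1 : ((n : ℂ) + 1) * ∑ l ∈ parts N (n + 1), schurPInf l * schur l X =
          ∑ l ∈ parts N (n + 1), ∑ i, if 1 ≤ l i ∧ Antitone (remBox l i) then
            schurPInf (remBox l i) * schur l X else 0 := by
        rw [Finset.mul_sum]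
        refine Finset.sum_congr rfl fun l hl => ?_
        obtain ⟨hla, hlw⟩ := mem_parts.1 hl
        have := sum_schurPInf_lower l
        rw [hlw, Finset.sum_congr rfl fun k _ => lower_eq_schurPInf hla k] at this
        push_cast at this
        rw [← mul_assoc, ← this, Finset.sum_mul]
        refine Finset.sum_congr rfl fun i _ => ?_
        rw [ite_mul, zero_mul]
      have h2 : (∑ l ∈ parts N n, schurPInf l * schur l X) * X.trace =
          ∑ l ∈ parts N n, ∑ i, if Antitone (addBoxes l {i}) then
            schurPInf l * schur (addBoxes l {i}) X else 0 := by
        rw [Finset.sum_mul]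
        refine Finset.sum_congr rfl fun l hl => ?_
        rw [mul_assoc, mul_comm (schur l X), ← sum_addBoxes_singleton, Finset.mul_sum]
        refine Finset.sum_congr rfl fun i _ => ?_
        split_ifs with h
        · rfl
        · rw [schur_addBoxes_eq_zero (mem_parts.1 hl).1 h, mul_zero]
      rw [h1, h2, ← Finset.sum_product', ← Finset.sum_product', ← Finset.sum_filter,
        ← Finset.sum_filter]
      refine Finset.sum_bij' (fun p _ => (addBoxes p.1 {p.2}, p.2))
        (fun p _ => (remBox p.1 p.2, p.2)) ?_ ?_ ?_ ?_ ?_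
      · rintro ⟨l, i⟩ h
        simp only [Finset.mem_filter, Finset.mem_product, mem_parts, Finset.mem_univ,
          and_true] at h ⊢
        refine ⟨⟨h.2, ?_⟩, ?_, ?_⟩
        · rw [wt_addBoxes, h.1.2]; simp
        · simp [addBoxes]
        · rw [remBox_addBoxes]; exact h.1.1
      · rintro ⟨l, i⟩ h
        simp only [Finset.mem_filter, Finset.mem_product, mem_parts, Finset.mem_univ,
          and_true] at h ⊢
        obtain ⟨⟨h1, h2⟩, h3, h4⟩ := h
        have := wt_addBoxes (remBox l i) {i}
        rw [addBoxes_remBox h3, h2, Finset.card_singleton] at this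
        refine ⟨⟨h4, by omega⟩, ?_⟩
        rw [addBoxes_remBox h3]; exact h1
      · rintro ⟨l, i⟩ h
        simp [remBox_addBoxes]
      · rintro ⟨l, i⟩ h
        simp only [Finset.mem_filter] at h
        simp [addBoxes_remBox h.2.1]
      · rintro ⟨l, i⟩ h
        simp [remBox_addBoxes]
    rw [mul_assoc, key]; ring

end expansion

/-- Partial sums of a finite sequence. -/
def psum {N : ℕ} (a : Fin N → ℕ) (k : ℕ) : ℕ := ∑ i : Fin N, if (i : ℕ) < k then a i else 0

/-- `f` is a polynomial function all of whose exponents are dominated by `κ`. -/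
def DomPoly {N : ℕ} (κ : Fin N → ℕ) (f : (Fin N → ℂ) → ℂ) : Prop :=
  ∃ p : MvPolynomial (Fin N) ℂ, (∀ t, f t = MvPolynomial.eval t p) ∧
    ∀ a ∈ p.support, ∀ k, psum a k ≤ psum κ k

section dominance
variable {N : ℕ}

lemma psum_add (a b : Fin N → ℕ) (k : ℕ) : psum (fun i => a i + b i) k = psum a k + psum b k := by
  simp only [psum, ← Finset.sum_add_distrib]
  exact Finset.sum_congr rfl fun i _ => by split_ifs <;> simp

lemma psum_indicator (S : Finset (Fin N)) (k : ℕ) :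
    psum (fun i => if i ∈ S then 1 else 0) k = (S.filter fun i : Fin N => (i : ℕ) < k).card := by
  rw [Finset.card_filter, psum, ← Finset.sum_filter_add_sum_filter_not Finset.univ (· ∈ S)]
  rw [Finset.filter_mem_eq_inter, Finset.univ_inter, add_eq_left.2]
  · exact Finset.sum_congr rfl fun i hi => by simp [hi]
  · refine Finset.sum_eq_zero fun i hi => ?_
    simp [(Finset.mem_filter.1 hi).2]

lemma psum_addBoxes (l : Fin N → ℕ) (S : Finset (Fin N)) (k : ℕ) :
    psum (addBoxes l S) k = psum l k + (S.filter fun i : Fin N => (i : ℕ) < k).card := by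
  rw [← psum_indicator, ← psum_add]; rfl

lemma DomPoly.mono {κ κ' : Fin N → ℕ} (h : ∀ k, psum κ k ≤ psum κ' k) {f : (Fin N → ℂ) → ℂ}
    (hf : DomPoly κ f) : DomPoly κ' f := by
  obtain ⟨p, hp, hs⟩ := hf
  exact ⟨p, hp, fun a ha k => (hs a ha k).trans (h k)⟩

lemma DomPoly.add {κ : Fin N → ℕ} {f g : (Fin N → ℂ) → ℂ} (hf : DomPoly κ f) (hg : DomPoly κ g) :
    DomPoly κ fun t => f t + g t := by
  obtain ⟨p, hp, hs⟩ := hf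
  obtain ⟨q, hq, hs'⟩ := hg
  refine ⟨p + q, fun t => by simp only [hp, hq, map_add], fun a ha => ?_⟩
  rcases Finset.mem_union.1 (MvPolynomial.support_add ha) with h | h
  · exact hs a h
  · exact hs' a h

lemma DomPoly.mul {κ κ' : Fin N → ℕ} {f g : (Fin N → ℂ) → ℂ} (hf : DomPoly κ f)
    (hg : DomPoly κ' g) : DomPoly (fun i => κ i + κ' i) fun t => f t * g t := by
  obtain ⟨p, hp, hs⟩ := hf
  obtain ⟨q, hq, hs'⟩ := hg
  refine ⟨p * q, fun t => by simp only [hp, hq, map_mul], fun a ha k => ?_⟩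
  obtain ⟨b, hb, c, hc, rfl⟩ := Finset.mem_add.1 (MvPolynomial.support_mul p q ha)
  rw [psum_add, Finsupp.coe_add]
  exact (psum_add b c k).le.trans (add_le_add (hs b hb k) (hs' c hc k))

lemma DomPoly.const (κ : Fin N → ℕ) (c : ℂ) : DomPoly κ fun _ => c := by
  refine ⟨MvPolynomial.C c, fun t => by simp, fun a ha k => ?_⟩
  have : a = 0 := by
    by_contra h
    simp [MvPolynomial.coeff_C, Ne.symm h] at ha
  subst this
  simp [psum]

lemma DomPoly.const_mul {κ : Fin N → ℕ} (c : ℂ) {f : (Fin N → ℂ) → ℂ} (hf : DomPoly κ f) :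
    DomPoly κ fun t => c * f t := by
  have := (DomPoly.const 0 c).mul hf
  simpa using this

lemma DomPoly.sum {ι : Type*} {κ : Fin N → ℕ} (s : Finset ι) {f : ι → (Fin N → ℂ) → ℂ}
    (hf : ∀ i ∈ s, DomPoly κ (f i)) : DomPoly κ fun t => ∑ i ∈ s, f i t := by
  induction s using Finset.induction_on with
  | empty => simpa using DomPoly.const κ 0
  | insert a s ha ih =>
    simp only [Finset.sum_insert ha]
    exact (hf a (by simp)).add (ih fun i hi => hf i (by simp [hi]))

lemma domPoly_prod {κ : Fin N → ℕ} {S : Finset (Fin N)}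
    (h : ∀ k, (S.filter fun i : Fin N => (i : ℕ) < k).card ≤ psum κ k) :
    DomPoly κ fun t => ∏ i ∈ S, t i := by
  refine ⟨MvPolynomial.monomial (∑ i ∈ S, Finsupp.single i 1) 1, fun t => ?_, fun a ha k => ?_⟩
  · rw [MvPolynomial.monomial_sum_one, map_prod]
    exact Finset.prod_congr rfl fun i _ => (MvPolynomial.eval_X (f := t) i).symm
  · have : a = ∑ i ∈ S, Finsupp.single i 1 := by
      have := MvPolynomial.support_monomial_subset ha
      simpa using this
    refine le_trans (le_of_eq ?_) (h k)
    rw [← psum_indicator, this]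
    congr 1
    ext i
    simp [Finsupp.finsetSum_apply, Finsupp.single_apply]

lemma eMat_diagonal_mul (r : ℕ) (t : Fin N → ℂ) (Z : Matrix (Fin N) (Fin N) ℂ) :
    eMat r (diagonal t * Z) = ∑ S ∈ (Finset.univ : Finset (Fin N)).powersetCard r,
      (Matrix.of fun i j => if i ∈ S then Z i j else (1 : Matrix (Fin N) (Fin N) ℂ) i j).det *
        ∏ i ∈ S, t i := by
  refine Finset.sum_congr rfl fun S _ => ?_
  have := Matrix.det_mul_column (fun i => if i ∈ S then t i else 1)
    (Matrix.of fun i j => if i ∈ S then Z i j else (1 : Matrix (Fin N) (Fin N) ℂ) i j)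
  rw [Finset.prod_ite_mem, Finset.univ_inter, mul_comm] at this
  rw [← this]
  congr 1
  ext i j
  by_cases hi : i ∈ S <;> simp [hi]

lemma card_filter_le_of_lower {R S : Finset (Fin N)} (hR : ∀ i ∈ R, ∀ j ≤ i, j ∈ R)
    (h : S.card = R.card) (k : ℕ) : (S.filter fun i : Fin N => (i : ℕ) < k).card ≤
      (R.filter fun i : Fin N => (i : ℕ) < k).card := by
  by_cases hk : ∀ i ∈ R, (i : ℕ) < k
  · rw [Finset.filter_true_of_mem hk, ← h]
    exact Finset.card_filter_le _ _
  · push Not at hk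
    obtain ⟨i, hi, hik⟩ := hk
    refine Finset.card_le_card fun j hj => ?_
    rw [Finset.mem_filter] at hj ⊢
    exact ⟨hR i hi j (Fin.le_def.2 (by omega)), hj.2⟩

lemma exists_card_filter_lt_of_lower {R S : Finset (Fin N)} (hR : ∀ i ∈ R, ∀ j ≤ i, j ∈ R)
    (h : S.card = R.card) (hne : S ≠ R) : ∃ k < N, (S.filter fun i : Fin N => (i : ℕ) < k).card <
      (R.filter fun i : Fin N => (i : ℕ) < k).card := by
  obtain ⟨i, hiS, hiR⟩ : ∃ i ∈ S, i ∉ R := by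
    by_contra hc
    push Not at hc
    exact hne (Finset.eq_of_subset_of_card_le hc h.ge)
  refine ⟨i, i.2, ?_⟩
  have hlt : ∀ j ∈ R, (j : ℕ) < i := fun j hj => by
    by_contra hc
    exact hiR (hR j hj i (Fin.le_def.2 (by omega)))
  rw [Finset.filter_true_of_mem hlt, ← h]
  refine Finset.card_lt_card ⟨Finset.filter_subset _ _, fun hsub => ?_⟩
  simpa using (Finset.mem_filter.1 (hsub hiS)).2

lemma domPoly_schur (Z : Matrix (Fin N) (Fin N) ℂ) {κ : Fin N → ℕ} (hκ : Antitone κ) :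
    DomPoly κ fun t => schur κ (diagonal t * Z) := by
  induction hm : ∑ k ∈ Finset.range (N + 1), psum κ k using Nat.strong_induction_on
    generalizing κ with
  | _ m ih =>
    by_cases h0 : κ = fun _ => 0
    · subst h0
      simp only [schur_zero]
      exact DomPoly.const _ 1
    set R : Finset (Fin N) := Finset.univ.filter fun i => 0 < κ i with hR
    have hlow : ∀ i ∈ R, ∀ j ≤ i, j ∈ R := by
      intro i hi j hj
      simp only [hR, Finset.mem_filter, Finset.mem_univ, true_and] at hi ⊢
      exact hi.trans_le (hκ hj)
    set μ : Fin N → ℕ := fun i => κ i - 1 with hμ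
    have hμa : Antitone μ := fun i j hij => Nat.sub_le_sub_right (hκ hij) 1
    have hκμ : addBoxes μ R = κ := by
      ext i
      simp only [addBoxes, hμ, hR, Finset.mem_filter, Finset.mem_univ, true_and]
      split_ifs <;> omega
    have hpos : 0 < R.card := by
      rw [Finset.card_pos]
      obtain ⟨i, hi⟩ := Function.ne_iff.1 h0
      exact ⟨i, by simpa [hR] using Nat.pos_of_ne_zero hi⟩
    have hpsκ : ∀ k, psum κ k = psum μ k + (R.filter fun i : Fin N => (i : ℕ) < k).card := fun k => by
      rw [← psum_addBoxes, hκμ]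
    have hps : ∀ S : Finset (Fin N), S.card = R.card → ∀ k, psum (addBoxes μ S) k ≤ psum κ k := by
      intro S hS k
      rw [hpsκ, psum_addBoxes]
      exact Nat.add_le_add_left (card_filter_le_of_lower hlow hS k) _
    have hμlt : ∑ k ∈ Finset.range (N + 1), psum μ k < m := by
      rw [← hm]
      refine Finset.sum_lt_sum (fun k _ => by rw [hpsκ]; omega) ⟨N, by simp, ?_⟩
      rw [hpsκ, Finset.filter_true_of_mem fun i _ => i.2]; omega
    have key : ∀ X : Matrix (Fin N) (Fin N) ℂ, schur κ X = eMat R.card X * schur μ X +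
        (-1) * ∑ S ∈ ((Finset.univ : Finset (Fin N)).powersetCard R.card).erase R,
          schur (addBoxes μ S) X := by
      intro X
      rw [← pieri, ← Finset.add_sum_erase _ _ (show R ∈ _ by simp : R ∈ (Finset.univ :
        Finset (Fin N)).powersetCard R.card), hκμ]
      ring
    simp only [key]
    refine DomPoly.add ?_ (DomPoly.const_mul _ (DomPoly.sum _ fun S hS => ?_))
    · have h1 : DomPoly (fun i => if i ∈ R then 1 else 0)
          fun t => eMat R.card (diagonal t * Z) := by
        simp only [eMat_diagonal_mul]
        refine DomPoly.sum _ fun S hS => DomPoly.const_mul _ (domPoly_prod fun k => ?_)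
        rw [psum_indicator]
        exact card_filter_le_of_lower hlow (Finset.mem_powersetCard.1 hS).2 k
      refine (h1.mul (ih _ hμlt hμa rfl)).mono fun k => ?_
      rw [psum_add, psum_indicator, hpsκ, add_comm]
    · rw [Finset.mem_erase, Finset.mem_powersetCard] at hS
      by_cases ha : Antitone (addBoxes μ S)
      · refine (ih _ ?_ ha rfl).mono (hps S hS.2.2)
        rw [← hm]
        obtain ⟨k, hk, hlt⟩ := exists_card_filter_lt_of_lower hlow hS.2.2 hS.1
        refine Finset.sum_lt_sum (fun k _ => hps S hS.2.2 k)
          ⟨k, by simp; omega, ?_⟩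
        rw [hpsκ, psum_addBoxes]; omega
      · simp only [schur_addBoxes_eq_zero hμa ha]
        exact DomPoly.const _ 0

end dominance

section symmetricPower
variable {N : ℕ}

/-- The linear substitution `x ↦ A x` on polynomials. -/
def linSubst (A : Matrix (Fin N) (Fin N) ℂ) :
    MvPolynomial (Fin N) ℂ →ₐ[ℂ] MvPolynomial (Fin N) ℂ :=
  MvPolynomial.aeval fun i => ∑ j, MvPolynomial.C (A i j) * MvPolynomial.X j

/-- The trace of `A` on the `k`-th symmetric power. -/
def symTrace (k : ℕ) (A : Matrix (Fin N) (Fin N) ℂ) : ℂ :=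
  ∑ a ∈ Finset.finsuppAntidiag (Finset.univ : Finset (Fin N)) k,
    (linSubst A (MvPolynomial.monomial a 1)).coeff a

lemma linSubst_monomial (A : Matrix (Fin N) (Fin N) ℂ) (a : Fin N →₀ ℕ) :
    linSubst A (MvPolynomial.monomial a 1) =
      ∏ i, (∑ j, MvPolynomial.C (A i j) * MvPolynomial.X j) ^ a i := by
  rw [linSubst, MvPolynomial.aeval_monomial, map_one, one_mul,
    Finsupp.prod_fintype _ _ (fun i => pow_zero _)]

lemma linSubst_comp (A B : Matrix (Fin N) (Fin N) ℂ) (p : MvPolynomial (Fin N) ℂ) :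
    linSubst A (linSubst B p) = linSubst (B * A) p := by
  have : (linSubst A).comp (linSubst B) = linSubst (B * A) := by
    refine MvPolynomial.algHom_ext fun i => ?_
    simp only [linSubst, AlgHom.comp_apply, MvPolynomial.aeval_X, map_sum, map_mul,
      MvPolynomial.algHom_C, Matrix.mul_apply, Finset.mul_sum, Finset.sum_mul,
      MvPolynomial.algebraMap_eq]
    rw [Finset.sum_comm]
    simp only [mul_assoc]
  exact DFunLike.congr_fun this p

lemma isHomogeneous_linSubst_monomial (A : Matrix (Fin N) (Fin N) ℂ) {k : ℕ} {a : Fin N →₀ ℕ}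
    (ha : ∑ i, a i = k) : (linSubst A (MvPolynomial.monomial a 1)).IsHomogeneous k := by
  rw [linSubst_monomial, ← ha]
  refine MvPolynomial.IsHomogeneous.prod _ _ _ fun i _ => ?_
  have : (∑ j, MvPolynomial.C (A i j) * MvPolynomial.X j : MvPolynomial (Fin N) ℂ).IsHomogeneous
      1 := by
    refine MvPolynomial.IsHomogeneous.sum _ _ _ fun j _ => ?_
    exact MvPolynomial.IsHomogeneous.C_mul (MvPolynomial.isHomogeneous_X _ _) _
  simpa using this.pow (a i)

lemma symTrace_mul (k : ℕ) (A B : Matrix (Fin N) (Fin N) ℂ) :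
    symTrace k (B * A) = ∑ a ∈ Finset.finsuppAntidiag (Finset.univ : Finset (Fin N)) k,
      ∑ c ∈ Finset.finsuppAntidiag (Finset.univ : Finset (Fin N)) k,
        (linSubst B (MvPolynomial.monomial a 1)).coeff c *
          (linSubst A (MvPolynomial.monomial c 1)).coeff a := by
  refine Finset.sum_congr rfl fun a ha => ?_
  rw [← linSubst_comp]
  have hs : (linSubst B (MvPolynomial.monomial a 1)).support ⊆
      Finset.finsuppAntidiag (Finset.univ : Finset (Fin N)) k := by
    intro c hc
    have h := isHomogeneous_linSubst_monomial B (Finset.mem_finsuppAntidiag.1 ha).1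
      (MvPolynomial.mem_support_iff.1 hc)
    rw [Finset.mem_finsuppAntidiag]
    refine ⟨?_, Finset.subset_univ _⟩
    rw [Finsupp.weight_apply, Finsupp.sum_fintype _ _ (by simp)] at h
    simpa using h
  set p := linSubst B (MvPolynomial.monomial a 1) with hp
  have e : p = ∑ c ∈ Finset.finsuppAntidiag (Finset.univ : Finset (Fin N)) k,
      p.coeff c • MvPolynomial.monomial c (1 : ℂ) := by
    conv_lhs => rw [p.as_sum]
    refine (Finset.sum_subset hs fun c _ hc => ?_).trans
      (Finset.sum_congr rfl fun c _ => ?_)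
    · rw [MvPolynomial.notMem_support_iff.1 hc, MvPolynomial.monomial_zero]
    · rw [MvPolynomial.smul_monomial, smul_eq_mul, mul_one]
  conv_lhs => rw [e]
  simp [MvPolynomial.coeff_sum]

lemma symTrace_mul_comm (k : ℕ) (A B : Matrix (Fin N) (Fin N) ℂ) :
    symTrace k (B * A) = symTrace k (A * B) := by
  rw [symTrace_mul, symTrace_mul, Finset.sum_comm]
  exact Finset.sum_congr rfl fun a _ => Finset.sum_congr rfl fun c _ => mul_comm _ _

lemma Ent.coeff_mul {f g : Matrix (Fin N) (Fin N) ℂ → MvPolynomial (Fin N) ℂ}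
    (hf : ∀ a, Ent fun A => (f A).coeff a) (hg : ∀ a, Ent fun A => (g A).coeff a)
    (a : Fin N →₀ ℕ) : Ent fun A => (f A * g A).coeff a := by
  simp only [MvPolynomial.coeff_mul]
  exact Ent.sum _ fun x _ => (hf _).mul (hg _)

lemma Ent.symTrace (k : ℕ) : Ent (N := N) fun A => symTrace k A := by
  refine Ent.sum _ fun a _ => ?_
  simp only [linSubst_monomial]
  have h1 : ∀ i a, Ent fun A : Matrix (Fin N) (Fin N) ℂ =>
      (∑ j, MvPolynomial.C (A i j) * MvPolynomial.X j : MvPolynomial (Fin N) ℂ).coeff a := by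
    intro i a
    simp only [MvPolynomial.coeff_sum, MvPolynomial.coeff_C_mul]
    exact Ent.sum _ fun j _ => (Ent.coord _ _).mul (Ent.const _)
  have h2 : ∀ (n : ℕ) i a, Ent fun A : Matrix (Fin N) (Fin N) ℂ =>
      ((∑ j, MvPolynomial.C (A i j) * MvPolynomial.X j : MvPolynomial (Fin N) ℂ) ^ n).coeff a := by
    intro n i
    induction n with
    | zero => intro a; simpa using Ent.const _
    | succ n ih =>
      simp only [pow_succ]
      exact Ent.coeff_mul ih (h1 i)
  have h3 : ∀ (s : Finset (Fin N)) (c : Fin N →₀ ℕ), Ent fun A : Matrix (Fin N) (Fin N) ℂ =>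
      (∏ i ∈ s, (∑ j, MvPolynomial.C (A i j) * MvPolynomial.X j :
        MvPolynomial (Fin N) ℂ) ^ a i).coeff c := by
    intro s
    induction s using Finset.induction_on with
    | empty => intro c; simpa using Ent.const _
    | insert i s hi ih =>
      simp only [Finset.prod_insert hi]
      exact Ent.coeff_mul (h2 _ i) ih
  exact h3 _ _

lemma ClassFn.symTrace (k : ℕ) : ClassFn (N := N) fun A => symTrace k A := by
  refine ⟨Ent.symTrace k, fun V X h => ?_⟩
  rw [symTrace_mul_comm, ← Matrix.mul_assoc, h, Matrix.one_mul]

lemma symTrace_diagonal (k : ℕ) (d : Fin N → ℂ) : symTrace k (diagonal d) =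
    ∑ a ∈ Finset.finsuppAntidiag (Finset.univ : Finset (Fin N)) k, ∏ i, d i ^ a i := by
  refine Finset.sum_congr rfl fun a _ => ?_
  rw [linSubst_monomial]
  have : ∀ i, (∑ j, MvPolynomial.C (diagonal d i j) * MvPolynomial.X j :
      MvPolynomial (Fin N) ℂ) = MvPolynomial.C (d i) * MvPolynomial.X i := by
    intro i
    rw [Finset.sum_eq_single i]
    · simp
    · intro j _ hj; simp [diagonal_apply_ne' d hj]
    · simp
  simp only [this, mul_pow, Finset.prod_mul_distrib, ← map_pow, ← map_prod]
  rw [MvPolynomial.coeff_C_mul]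
  have e := MvPolynomial.monomial_eq (s := a) (a := (1 : ℂ))
  rw [Finsupp.prod_fintype _ _ (fun i => pow_zero _), MvPolynomial.C_1, one_mul] at e
  rw [← e]
  simp

lemma symTrace_eq_hMat (k : ℕ) : (fun A : Matrix (Fin N) (Fin N) ℂ => symTrace k A) =
    fun A => hMat A k := by
  refine (ClassFn.symTrace k).eq (ClassFn.hMat k) fun d => ?_
  have h1 : PowerSeries.mk (fun k => symTrace k (diagonal d)) =
      ∏ i, PowerSeries.mk (fun n => d i ^ n) := by
    ext k
    rw [PowerSeries.coeff_mk, PowerSeries.coeff_prod, symTrace_diagonal]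
    simp
  have h2 : ∀ c : ℂ, PowerSeries.mk (fun n => c ^ n) * (1 - PowerSeries.C c * PowerSeries.X)
      = 1 := by
    intro c
    ext n
    cases n with
    | zero => simp [mul_sub]
    | succ n =>
      rw [mul_sub, ← mul_assoc, map_sub, PowerSeries.coeff_succ_mul_X, mul_comm _ (PowerSeries.C c),
        PowerSeries.coeff_C_mul]
      simp [pow_succ, mul_comm, PowerSeries.coeff_one]
  have h3 : PowerSeries.mk (fun k => symTrace k (diagonal d)) *
      ∏ i, (1 - PowerSeries.C (d i) * PowerSeries.X) = 1 := by
    rw [h1, ← Finset.prod_mul_distrib, Finset.prod_eq_one fun i _ => h2 (d i)]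
  have h4 := hMat_series d
  have h5 : PowerSeries.mk (fun k => symTrace k (diagonal d)) = PowerSeries.mk (hMat (diagonal d)) := by
    rw [mul_comm] at h4
    exact left_inv_eq_right_inv h3 h4
  simpa using congrArg (PowerSeries.coeff k) h5

end symmetricPower

section extraction
variable {N : ℕ}

lemma mem_of_forall_sum_mem {V : Type*} [AddCommGroup V] [Module ℂ V] (W : Submodule ℂ V)
    (s : Finset (Fin N → ℕ)) (v : (Fin N → ℕ) → V)
    (h : ∀ t : Fin N → ℂ, ∑ a ∈ s, (∏ i, t i ^ a i) • v a ∈ W) {a : Fin N → ℕ} (ha : a ∈ s) :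
    v a ∈ W := by
  by_contra hv
  obtain ⟨f, hf, hW⟩ := Submodule.exists_le_ker_of_notMem hv
  set p : MvPolynomial (Fin N) ℂ :=
    ∑ a ∈ s, MvPolynomial.monomial (Finsupp.equivFunOnFinite.symm a) (f (v a)) with hp
  have hp0 : p = 0 := by
    refine MvPolynomial.funext fun t => ?_
    have := LinearMap.mem_ker.1 (hW (h t))
    rw [map_sum] at this
    rw [hp, map_sum, map_zero, ← this]
    refine Finset.sum_congr rfl fun a _ => ?_
    rw [MvPolynomial.eval_monomial, Finsupp.prod_fintype _ _ (fun i => pow_zero _), map_smul,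
      smul_eq_mul, mul_comm]
    rfl
  have := congrArg (MvPolynomial.coeff (Finsupp.equivFunOnFinite.symm a)) hp0
  rw [hp, MvPolynomial.coeff_sum, Finset.sum_eq_single a] at this
  · simp at this; exact hf this
  · intro b _ hb
    rw [MvPolynomial.coeff_monomial, if_neg]
    simpa using hb
  · exact fun h => (h ha).elim

end extraction

section rankOne
variable {N : ℕ}

/-- The span of the functions `A ↦ (uᵀ A v)^k`. -/
def rankOneSpan (N k : ℕ) : Submodule ℂ (Matrix (Fin N) (Fin N) ℂ → ℂ) :=
  Submodule.span ℂ (Set.range fun uv : (Fin N → ℂ) × (Fin N → ℂ) =>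
    fun A => (uv.1 ⬝ᵥ A *ᵥ uv.2) ^ k)

lemma prod_mulVec_mem (k : ℕ) (v : Fin N → ℂ) {a : Fin N → ℕ}
    (ha : a ∈ Finset.piAntidiag (Finset.univ : Finset (Fin N)) k) :
    (fun A : Matrix (Fin N) (Fin N) ℂ => ∏ i, (A *ᵥ v) i ^ a i) ∈ rankOneSpan N k := by
  have h := mem_of_forall_sum_mem (rankOneSpan N k)
    (Finset.piAntidiag (Finset.univ : Finset (Fin N)) k)
    (fun a => (Nat.multinomial Finset.univ a : ℂ) •
      (fun A : Matrix (Fin N) (Fin N) ℂ => ∏ i, (A *ᵥ v) i ^ a i)) (fun t => by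
    have : (fun A : Matrix (Fin N) (Fin N) ℂ => (t ⬝ᵥ A *ᵥ v) ^ k) ∈ rankOneSpan N k :=
      Submodule.subset_span ⟨(t, v), rfl⟩
    convert this using 1
    ext A
    rw [dotProduct, Finset.sum_pow_eq_sum_piAntidiag, Finset.sum_apply]
    refine Finset.sum_congr rfl fun a _ => ?_
    simp only [Pi.smul_apply, smul_eq_mul, mul_pow, Finset.prod_mul_distrib]
    ring) ha
  have h0 : (Nat.multinomial Finset.univ a : ℂ) ≠ 0 := by
    exact_mod_cast (Nat.multinomial_pos _ _).ne'
  exact (Submodule.smul_mem_iff _ h0).1 h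

lemma hMat_mem_rankOneSpan (k : ℕ) :
    (fun A : Matrix (Fin N) (Fin N) ℂ => hMat A k) ∈ rankOneSpan N k := by
  rw [← symTrace_eq_hMat]
  have : (fun A : Matrix (Fin N) (Fin N) ℂ => symTrace k A) =
      ∑ a ∈ Finset.finsuppAntidiag (Finset.univ : Finset (Fin N)) k,
        fun A => (linSubst A (MvPolynomial.monomial a 1)).coeff a := by
    ext A; simp [symTrace]
  rw [this]
  refine Submodule.sum_mem _ fun a ha => ?_
  have ha' : ⇑a ∈ Finset.piAntidiag (Finset.univ : Finset (Fin N)) k := by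
    rw [Finset.mem_piAntidiag]
    exact ⟨(Finset.mem_finsuppAntidiag.1 ha).1, fun i _ => Finset.mem_univ i⟩
  have h := mem_of_forall_sum_mem (rankOneSpan N k)
    (Finset.piAntidiag (Finset.univ : Finset (Fin N)) k)
    (fun c => fun A : Matrix (Fin N) (Fin N) ℂ =>
      (linSubst A (MvPolynomial.monomial a 1)).coeff (Finsupp.equivFunOnFinite.symm c))
    (fun t => by
      convert prod_mulVec_mem k t ha' using 1
      ext A
      have e : ∏ i, (A *ᵥ t) i ^ a i =
          MvPolynomial.eval t (linSubst A (MvPolynomial.monomial a 1)) := by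
        rw [linSubst_monomial, map_prod]
        simp [Matrix.mulVec, dotProduct]
      rw [e, MvPolynomial.eval_eq', Finset.sum_apply]
      symm
      refine Finset.sum_bij_ne_zero (fun c _ _ => ⇑c) ?_ ?_ ?_ ?_
      · intro c hc _
        have h := isHomogeneous_linSubst_monomial A (Finset.mem_finsuppAntidiag.1 ha).1
          (MvPolynomial.mem_support_iff.1 hc)
        rw [Finsupp.weight_apply, Finsupp.sum_fintype _ _ (by simp)] at h
        rw [Finset.mem_piAntidiag]
        exact ⟨by simpa using h, fun i _ => Finset.mem_univ i⟩
      · intro c _ _ c' _ _ h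
        exact DFunLike.coe_injective h
      · intro c _ hc
        refine ⟨Finsupp.equivFunOnFinite.symm c, ?_, ?_, rfl⟩
        · rw [MvPolynomial.mem_support_iff]
          intro h0
          exact hc (by simp [h0])
        · rw [mul_comm]; exact hc
      · intro c _ _
        simp only [Pi.smul_apply, smul_eq_mul]
        rw [mul_comm, Finsupp.equivFunOnFinite_symm_coe]) ha'
  simpa only [Finsupp.equivFunOnFinite_symm_coe] using h

end rankOne

section pairing
variable {N : ℕ}

/-- The span of the functions `A ↦ ∏ i, (U A V)_{ii}^{a_i}` whose exponents dominate `l`. -/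
def domSpan (l : Fin N → ℕ) (n : ℕ) : Submodule ℂ (Matrix (Fin N) (Fin N) ℂ → ℂ) :=
  Submodule.span ℂ {f | ∃ (a : Fin N → ℕ) (U V : Matrix (Fin N) (Fin N) ℂ),
    a ∈ Finset.piAntidiag (Finset.univ : Finset (Fin N)) n ∧ (∀ k, psum l k ≤ psum a k) ∧
      f = fun A => ∏ i, (U * A * V) i i ^ a i}

lemma prod_hMat_mem_domSpan {l a : Fin N → ℕ} {n : ℕ}
    (ha : a ∈ Finset.piAntidiag (Finset.univ : Finset (Fin N)) n)
    (hla : ∀ k, psum l k ≤ psum a k) :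
    (fun A : Matrix (Fin N) (Fin N) ℂ => ∏ i, hMat A (a i)) ∈ domSpan l n := by
  have h1 : ∀ s : Finset (Fin N), (∏ i ∈ s, fun A : Matrix (Fin N) (Fin N) ℂ => hMat A (a i)) ∈
      ∏ i ∈ s, rankOneSpan N (a i) := by
    intro s
    induction s using Finset.induction_on with
    | empty => simp only [Finset.prod_empty]; exact Submodule.one_le.1 le_rfl
    | insert i s hi ih =>
      rw [Finset.prod_insert hi, Finset.prod_insert hi]
      exact Submodule.mul_mem_mul (hMat_mem_rankOneSpan _) ih
  have h2 := h1 Finset.univ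
  simp only [rankOneSpan] at h2
  rw [Submodule.prod_span] at h2
  have h3 : (∏ i, fun A : Matrix (Fin N) (Fin N) ℂ => hMat A (a i)) =
      fun A : Matrix (Fin N) (Fin N) ℂ => ∏ i, hMat A (a i) := by
    ext A; simp
  rw [h3] at h2
  refine Submodule.span_mono ?_ h2
  intro f hf
  rw [Set.mem_fintype_prod] at hf
  obtain ⟨g, hg, rfl⟩ := hf
  choose uv huv using hg
  refine ⟨a, Matrix.of fun i => (uv i).1, (Matrix.of fun i => (uv i).2)ᵀ, ha, hla, ?_⟩
  ext A
  rw [Finset.prod_apply]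
  refine Finset.prod_congr rfl fun i _ => ?_
  rw [← huv i, Matrix.mul_assoc, Matrix.mul_apply]
  rfl

lemma sum_range_le_sum_perm (σ : Equiv.Perm (Fin N)) (k : ℕ) :
    (∑ i : Fin N, if (i : ℕ) < k then ((i : ℕ) : ℤ) else 0) ≤
      ∑ i : Fin N, if (i : ℕ) < k then ((σ i : ℕ) : ℤ) else 0 := by
  have h1 : ∑ i : Fin N, min (((σ i : ℕ) : ℤ) - k) 0 = ∑ i : Fin N, min (((i : ℕ) : ℤ) - k) 0 :=
    Equiv.sum_comp σ fun i : Fin N => min (((i : ℕ) : ℤ) - k) 0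
  have h2 : ∑ i : Fin N, min (((i : ℕ) : ℤ) - k) 0 =
      ∑ i : Fin N, ((if (i : ℕ) < k then ((i : ℕ) : ℤ) else 0) - if (i : ℕ) < k then (k : ℤ) else 0) := by
    refine Finset.sum_congr rfl fun i _ => ?_
    split_ifs <;> omega
  have h3 : ∑ i : Fin N, min (((σ i : ℕ) : ℤ) - k) 0 ≤
      ∑ i : Fin N, ((if (i : ℕ) < k then ((σ i : ℕ) : ℤ) else 0) - if (i : ℕ) < k then (k : ℤ) else 0) := by
    refine Finset.sum_le_sum fun i _ => ?_
    split_ifs <;> omega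
  rw [Finset.sum_sub_distrib] at h2 h3
  linarith

lemma schur_mem_domSpan (l : Fin N → ℕ) : (fun A => schur l A) ∈ domSpan l (wt l) := by
  have h : (fun A => schur l A) = ∑ σ : Equiv.Perm (Fin N), ((Equiv.Perm.sign σ : ℤ) : ℂ) •
      fun A : Matrix (Fin N) (Fin N) ℂ => ∏ i, hMatZ A ((l i : ℤ) - (i : ℤ) + (σ i : ℤ)) := by
    ext A
    rw [schur, ← Matrix.det_transpose, Matrix.det_apply']
    simp
  rw [h]
  refine Submodule.sum_mem _ fun σ _ => Submodule.smul_mem _ _ ?_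
  by_cases hn : ∃ i, (l i : ℤ) - (i : ℤ) + (σ i : ℤ) < 0
  · obtain ⟨i, hi⟩ := hn
    have : (fun A : Matrix (Fin N) (Fin N) ℂ =>
        ∏ i, hMatZ A ((l i : ℤ) - (i : ℤ) + (σ i : ℤ))) = 0 := by
      ext A
      exact Finset.prod_eq_zero (Finset.mem_univ i) (by rw [hMatZ, if_pos hi])
    rw [this]
    exact Submodule.zero_mem _
  · push Not at hn
    choose a ha using fun i => Int.eq_ofNat_of_zero_le (hn i)
    have h1 : (fun A : Matrix (Fin N) (Fin N) ℂ =>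
        ∏ i, hMatZ A ((l i : ℤ) - (i : ℤ) + (σ i : ℤ))) = fun A => ∏ i, hMat A (a i) := by
      ext A
      refine Finset.prod_congr rfl fun i _ => ?_
      rw [ha, hMatZ, if_neg (by simp), Int.toNat_natCast]
    rw [h1]
    refine prod_hMat_mem_domSpan ?_ fun k => ?_
    · rw [Finset.mem_piAntidiag]
      refine ⟨?_, fun i _ => Finset.mem_univ i⟩
      have : ∑ i, (a i : ℤ) = ∑ i, (l i : ℤ) := by
        rw [← Finset.sum_congr rfl fun i _ => ha i, Finset.sum_add_distrib,
          Finset.sum_sub_distrib, Equiv.sum_comp σ fun i : Fin N => ((i : ℕ) : ℤ)]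
        ring
      rw [wt]
      exact_mod_cast this
    · have h2 := sum_range_le_sum_perm σ k
      have h3 : (psum a k : ℤ) = psum l k - (∑ i : Fin N, if (i : ℕ) < k then ((i : ℕ) : ℤ) else 0)
          + ∑ i : Fin N, if (i : ℕ) < k then ((σ i : ℕ) : ℤ) else 0 := by
        simp only [psum]
        push_cast
        rw [← Finset.sum_sub_distrib, ← Finset.sum_add_distrib]
        refine Finset.sum_congr rfl fun i _ => ?_
        have := ha i
        split_ifs <;> omega
      omega

lemma trace_diag_pow (U V A : Matrix (Fin N) (Fin N) ℂ) (t : Fin N → ℂ) (n : ℕ) :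
    (V * diagonal t * U * A).trace ^ n =
      ∑ b ∈ Finset.piAntidiag (Finset.univ : Finset (Fin N)) n, (∏ i, t i ^ b i) *
        ((Nat.multinomial Finset.univ b : ℂ) * ∏ i, (U * A * V) i i ^ b i) := by
  have : (V * diagonal t * U * A).trace = ∑ i, t i * (U * A * V) i i := by
    rw [Matrix.mul_assoc, Matrix.mul_assoc, Matrix.trace_mul_comm, Matrix.mul_assoc, Matrix.trace]
    simp [diagonal_mul]
  rw [this, Finset.sum_pow_eq_sum_piAntidiag]
  refine Finset.sum_congr rfl fun b _ => ?_
  simp only [mul_pow, Finset.prod_mul_distrib]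
  ring

/-- The span of the functions `A ↦ Tr(X A)^n`. -/
def tracePowSpan (N n : ℕ) : Submodule ℂ (Matrix (Fin N) (Fin N) ℂ → ℂ) :=
  Submodule.span ℂ (Set.range fun X : Matrix (Fin N) (Fin N) ℂ => fun A => (X * A).trace ^ n)

lemma domSpan_le_tracePowSpan (l : Fin N → ℕ) (n : ℕ) : domSpan l n ≤ tracePowSpan N n := by
  refine Submodule.span_le.2 ?_
  rintro _ ⟨a, U, V, ha, -, rfl⟩
  have h := mem_of_forall_sum_mem (tracePowSpan N n)
    (Finset.piAntidiag (Finset.univ : Finset (Fin N)) n)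
    (fun b => (Nat.multinomial Finset.univ b : ℂ) •
      (fun A : Matrix (Fin N) (Fin N) ℂ => ∏ i, (U * A * V) i i ^ b i)) (fun t => by
    have : (fun A : Matrix (Fin N) (Fin N) ℂ => (V * diagonal t * U * A).trace ^ n) ∈
        tracePowSpan N n := Submodule.subset_span ⟨V * diagonal t * U, rfl⟩
    convert this using 1
    ext A
    rw [trace_diag_pow, Finset.sum_apply]
    rfl) ha
  have h0 : (Nat.multinomial Finset.univ a : ℂ) ≠ 0 := by
    exact_mod_cast (Nat.multinomial_pos _ _).ne'
  exact (Submodule.smul_mem_iff _ h0).1 h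

lemma exists_schur_eq_sum (l : Fin N → ℕ) : ∃ ν : Matrix (Fin N) (Fin N) ℂ →₀ ℂ,
    ∀ A, schur l A = ν.sum fun Z c => c * (Z * A).trace ^ wt l := by
  have h := domSpan_le_tracePowSpan l (wt l) (schur_mem_domSpan l)
  rw [tracePowSpan, Finsupp.mem_span_range_iff_exists_finsupp] at h
  obtain ⟨ν, hν⟩ := h
  refine ⟨ν, fun A => ?_⟩
  have := congrFun hν A
  rw [← this, Finsupp.sum, Finsupp.sum, Finset.sum_apply]
  rfl

/-- Coefficients expressing `s_l` through powers of linear forms. -/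
def schurCoeff (l : Fin N → ℕ) : Matrix (Fin N) (Fin N) ℂ →₀ ℂ := (exists_schur_eq_sum l).choose

lemma schur_eq_sum (l : Fin N → ℕ) (A : Matrix (Fin N) (Fin N) ℂ) :
    schur l A = (schurCoeff l).sum fun Z c => c * (Z * A).trace ^ wt l :=
  (exists_schur_eq_sum l).choose_spec A

/-- The pairing of `s_l` (with argument multiplied by `C`) and `s_k`. -/
def schurPair (l k : Fin N → ℕ) (C : Matrix (Fin N) (Fin N) ℂ) : ℂ :=
  (schurCoeff k).sum fun Z c => c * schur l (C * Z)

lemma schurPair_comm {l k : Fin N → ℕ} (h : wt l = wt k) (C : Matrix (Fin N) (Fin N) ℂ) :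
    schurPair l k C = schurPair k l C := by
  simp only [schurPair, Finsupp.sum]
  have e1 : ∀ Z, schur l (C * Z) = ∑ Y ∈ (schurCoeff l).support,
      schurCoeff l Y * (Z * Y * C).trace ^ wt l := by
    intro Z
    rw [schur_eq_sum, Finsupp.sum]
    refine Finset.sum_congr rfl fun Y _ => ?_
    rw [Matrix.trace_mul_comm, Matrix.mul_assoc, Matrix.trace_mul_comm]
  have e2 : ∀ Y, schur k (C * Y) = ∑ Z ∈ (schurCoeff k).support,
      schurCoeff k Z * (Z * Y * C).trace ^ wt k := by
    intro Y
    rw [schur_mul_comm, schur_eq_sum, Finsupp.sum]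
    refine Finset.sum_congr rfl fun Z _ => ?_
    rw [Matrix.mul_assoc]
  simp only [e1, e2, Finset.mul_sum]
  rw [Finset.sum_comm]
  refine Finset.sum_congr rfl fun Z _ => Finset.sum_congr rfl fun Y _ => ?_
  rw [h]; ring

lemma schurPair_eq_zero_of_not_dom {l k : Fin N → ℕ} (hk : Antitone k) (h : wt l = wt k) {j : ℕ}
    (hj : psum k j < psum l j) (C : Matrix (Fin N) (Fin N) ℂ) : schurPair l k C = 0 := by
  let ell : (Matrix (Fin N) (Fin N) ℂ → ℂ) →ₗ[ℂ] ℂ :=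
    ∑ Z ∈ (schurCoeff k).support, schurCoeff k Z • LinearMap.proj (C * Z)
  have hell : ∀ f, ell f = ∑ Z ∈ (schurCoeff k).support, schurCoeff k Z * f (C * Z) := by
    intro f; simp [ell]
  suffices hle : domSpan l (wt l) ≤ LinearMap.ker ell by
    have := LinearMap.mem_ker.1 (hle (schur_mem_domSpan l))
    rw [hell] at this
    exact this
  refine Submodule.span_le.2 ?_
  rintro _ ⟨a, U, V, ha, hla, rfl⟩
  obtain ⟨p, hp, hs⟩ := domPoly_schur (U * C * V) hk
  set q : MvPolynomial (Fin N) ℂ :=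
    ∑ b ∈ Finset.piAntidiag (Finset.univ : Finset (Fin N)) (wt l),
      MvPolynomial.monomial (Finsupp.equivFunOnFinite.symm b)
        ((Nat.multinomial Finset.univ b : ℂ) * ell fun A => ∏ i, (U * A * V) i i ^ b i) with hq
  have hpq : p = q := by
    refine MvPolynomial.funext fun t => ?_
    have e : schur k (diagonal t * (U * C * V)) = schur k (V * diagonal t * U * C) := by
      rw [← Matrix.mul_assoc, schur_mul_comm]
      simp only [Matrix.mul_assoc]
    rw [← hp]
    beta_reduce
    rw [e, schur_eq_sum, hq, map_sum]
    simp only [hell, MvPolynomial.eval_monomial, Finsupp.sum, Finset.mul_sum, Finset.sum_mul]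
    rw [Finset.sum_comm]
    refine Finset.sum_congr rfl fun Z _ => ?_
    have : (Z * (V * diagonal t * U * C)).trace = (V * diagonal t * U * (C * Z)).trace := by
      rw [Matrix.trace_mul_comm, Matrix.mul_assoc]
    rw [this, ← h, trace_diag_pow, Finset.mul_sum]
    refine Finset.sum_congr rfl fun b _ => ?_
    rw [Finsupp.prod_fintype _ _ (fun i => pow_zero _)]
    simp only [Finsupp.equivFunOnFinite_symm_apply_apply]
    ring
  have h0 : (Nat.multinomial Finset.univ a : ℂ) ≠ 0 := by
    exact_mod_cast (Nat.multinomial_pos _ _).ne'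
  have hc : q.coeff (Finsupp.equivFunOnFinite.symm a) =
      (Nat.multinomial Finset.univ a : ℂ) * ell fun A => ∏ i, (U * A * V) i i ^ a i := by
    rw [hq, MvPolynomial.coeff_sum, Finset.sum_eq_single a]
    · simp
    · intro b _ hb
      rw [MvPolynomial.coeff_monomial, if_neg]
      simpa using hb
    · exact fun h => (h ha).elim
  have hz : q.coeff (Finsupp.equivFunOnFinite.symm a) = 0 := by
    by_contra hne
    rw [← hpq] at hne
    have h1 := hs _ (MvPolynomial.mem_support_iff.2 hne) j
    have h2 := hla j
    exact absurd (h2.trans h1) (by omega)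
  rw [hc] at hz
  exact (mul_eq_zero.1 hz).resolve_left h0

lemma eq_of_psum_eq {l k : Fin N → ℕ} (h : ∀ j, psum l j = psum k j) : l = k := by
  have key : ∀ (a : Fin N → ℕ) (i : Fin N), psum a ((i : ℕ) + 1) = psum a i + a i := by
    intro a i
    have : a i = ∑ j : Fin N, if j = i then a j else 0 := by simp
    rw [this, psum, psum, ← Finset.sum_add_distrib]
    refine Finset.sum_congr rfl fun j _ => ?_
    rcases lt_trichotomy j i with hj | hj | hj
    · have := Fin.lt_def.1 hj
      simp [hj.ne, this, Nat.lt_succ_of_lt this]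
    · subst hj; simp
    · have := Fin.lt_def.1 hj
      rw [if_neg (by omega), if_neg (by omega), if_neg hj.ne']
  ext i
  have := h ((i : ℕ) + 1)
  rw [key, key, h] at this
  omega

lemma schurPair_eq_zero {l k : Fin N → ℕ} (hl : Antitone l) (hk : Antitone k) (h : wt l = wt k)
    (hne : l ≠ k) (C : Matrix (Fin N) (Fin N) ℂ) : schurPair l k C = 0 := by
  by_cases h1 : ∃ j, psum k j < psum l j
  · obtain ⟨j, hj⟩ := h1
    exact schurPair_eq_zero_of_not_dom hk h hj C
  · by_cases h2 : ∃ j, psum l j < psum k j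
    · obtain ⟨j, hj⟩ := h2
      rw [schurPair_comm h]
      exact schurPair_eq_zero_of_not_dom hl h.symm hj C
    · push Not at h1 h2
      exact (hne (eq_of_psum_eq fun j => le_antisymm (h1 j) (h2 j))).elim

lemma schur_eq_schurPair {k : Fin N → ℕ} (hk : Antitone k) (C : Matrix (Fin N) (Fin N) ℂ) :
    schur k C = (wt k).factorial * schurPInf k * schurPair k k C := by
  have e : ∀ Z : Matrix (Fin N) (Fin N) ℂ, (Z * C).trace ^ wt k =
      (wt k).factorial * ∑ l ∈ parts N (wt k), schurPInf l * schur l (C * Z) := by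
    intro Z
    rw [Matrix.trace_mul_comm, trace_pow_expansion]
  rw [schur_eq_sum]
  simp only [e, Finsupp.sum, Finset.mul_sum]
  rw [Finset.sum_comm, Finset.sum_eq_single k]
  · rw [schurPair, Finsupp.sum, Finset.mul_sum]
    exact Finset.sum_congr rfl fun Z _ => by ring
  · intro l hl hlk
    obtain ⟨hl1, hl2⟩ := mem_parts.1 hl
    have := schurPair_eq_zero hl1 hk hl2 hlk C
    rw [schurPair, Finsupp.sum] at this
    have e2 : ∀ Z ∈ (schurCoeff k).support, schurCoeff k Z * ((wt k).factorial * (schurPInf l *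
      schur l (C * Z))) = (wt k).factorial * schurPInf l * (schurCoeff k Z * schur l (C * Z)) :=
      fun Z _ => by ring
    rw [Finset.sum_congr rfl e2, ← Finset.mul_sum, this, mul_zero]
  · intro h
    exact (h (mem_parts.2 ⟨hk, rfl⟩)).elim

end pairing

section haar
variable {N : ℕ}

instance : BorelSpace (UN N) := ⟨rfl⟩

lemma isClosed_unitary_set : IsClosed {M : Matrix (Fin N) (Fin N) ℂ | M ∈ Matrix.unitaryGroup (Fin N) ℂ} := by
  have : {M : Matrix (Fin N) (Fin N) ℂ | M ∈ Matrix.unitaryGroup (Fin N) ℂ} = {M | M * Mᴴ = 1} := by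
    ext M; exact Matrix.mem_unitaryGroup_iff
  rw [this]
  exact isClosed_eq (by fun_prop) continuous_const

instance : CompactSpace (UN N) := by
  refine isCompact_iff_compactSpace.1 ?_
  have hK : IsCompact (Set.pi Set.univ fun _ : Fin N => Set.pi Set.univ fun _ : Fin N =>
      Metric.closedBall (0 : ℂ) 1) :=
    isCompact_univ_pi fun _ => isCompact_univ_pi fun _ => isCompact_closedBall 0 1
  refine hK.of_isClosed_subset (isClosed_unitary_set (N := N)) fun M hM i _ j _ => ?_
  simpa using entry_norm_bound_of_unitary hM i j

variable (μ : Measure (UN N)) [μ.IsHaarMeasure]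

lemma integrable_of_continuous {f : UN N → ℂ} (hf : Continuous f) : Integrable f μ :=
  hf.integrable_of_hasCompactSupport (HasCompactSupport.of_compactSpace f)

lemma integral_mul_left_UN (f : UN N → ℂ) (W : UN N) : ∫ U, f (W * U) ∂μ = ∫ U, f U ∂μ :=
  integral_mul_left_eq_self f W

lemma continuous_coe_UN : Continuous fun U : UN N => (U : Matrix (Fin N) (Fin N) ℂ) :=
  continuous_subtype_val

lemma continuous_trace_mul (A : Matrix (Fin N) (Fin N) ℂ) :
    Continuous fun U : UN N => ((U : Matrix (Fin N) (Fin N) ℂ) * A).trace :=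
  (continuous_coe_UN.matrix_mul continuous_const).matrix_trace

lemma continuous_trace_star_mul (A : Matrix (Fin N) (Fin N) ℂ) :
    Continuous fun U : UN N => ((U : Matrix (Fin N) (Fin N) ℂ)ᴴ * A).trace :=
  (continuous_coe_UN.matrix_conjTranspose.matrix_mul continuous_const).matrix_trace

lemma Ent.integral_trace_pow {φ : UN N → Matrix (Fin N) (Fin N) ℂ} (hφ : Continuous φ)
    {g : UN N → ℂ} (hg : Continuous g) (n : ℕ) :
    Ent fun A => ∫ U, (φ U * A).trace ^ n * g U ∂μ := by
  have e : ∀ A : Matrix (Fin N) (Fin N) ℂ, ∫ U, (φ U * A).trace ^ n * g U ∂μ =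
      ∑ a ∈ Finset.piAntidiag (Finset.univ : Finset (Fin N × Fin N)) n,
        (∏ x, A x.2 x.1 ^ a x) *
        ∫ U, (Nat.multinomial Finset.univ a : ℂ) * (∏ x, φ U x.1 x.2 ^ a x) * g U ∂μ := by
    intro A
    simp only [← integral_const_mul]
    rw [← integral_finsetSum]
    · congr 1
      ext U
      have : (φ U * A).trace = ∑ x : Fin N × Fin N, φ U x.1 x.2 * A x.2 x.1 := by
        rw [Fintype.sum_prod_type, Matrix.trace]
        simp [Matrix.mul_apply]
      rw [this, Finset.sum_pow_eq_sum_piAntidiag, Finset.sum_mul]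
      refine Finset.sum_congr rfl fun a _ => ?_
      simp only [mul_pow, Finset.prod_mul_distrib]
      ring
    · intro a _
      refine integrable_of_continuous μ ?_
      have : ∀ i j, Continuous fun U => φ U i j := fun i j => hφ.matrix_elem i j
      fun_prop
  simp only [e]
  exact Ent.sum _ fun a _ => (Ent.prod _ fun x _ => (Ent.coord _ _).pow _).mul (Ent.const _)

/-- The moments `∫ Tr(UA)^n Tr(U†B)^n dU`. -/
def bgwMoment (n : ℕ) (A B : Matrix (Fin N) (Fin N) ℂ) : ℂ :=
  ∫ U : UN N, ((U : Matrix (Fin N) (Fin N) ℂ) * A).trace ^ n *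
    ((U : Matrix (Fin N) (Fin N) ℂ)ᴴ * B).trace ^ n ∂μ

lemma bgwMoment_left (n : ℕ) (A B W : Matrix (Fin N) (Fin N) ℂ) (hW : Wᴴ * W = 1) :
    bgwMoment μ n (A * W) (Wᴴ * B) = bgwMoment μ n A B := by
  have hW' : W ∈ Matrix.unitaryGroup (Fin N) ℂ := Matrix.mem_unitaryGroup_iff'.2 hW
  rw [bgwMoment, bgwMoment]
  conv_rhs => rw [← integral_mul_left_UN μ _ ⟨W, hW'⟩]
  congr 1
  ext U
  simp only [Submonoid.coe_mul, Matrix.conjTranspose_mul]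
  rw [← Matrix.mul_assoc, Matrix.trace_mul_comm, ← Matrix.mul_assoc, ← Matrix.mul_assoc]

lemma Ent.bgwMoment_fst (n : ℕ) (B : Matrix (Fin N) (Fin N) ℂ) :
    Ent fun A => bgwMoment μ n A B :=
  Ent.integral_trace_pow μ continuous_coe_UN ((continuous_trace_star_mul B).pow n) n

lemma Ent.bgwMoment_snd (n : ℕ) (A : Matrix (Fin N) (Fin N) ℂ) :
    Ent fun B => bgwMoment μ n A B := by
  have := Ent.integral_trace_pow μ (continuous_coe_UN (N := N)).matrix_conjTranspose
    ((continuous_trace_mul A).pow n) n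
  simpa only [bgwMoment, mul_comm, Pi.pow_apply] using this

variable [IsProbabilityMeasure μ]

lemma integral_mul_right_UN (f : UN N → ℂ) (W : UN N) : ∫ U, f (U * W) ∂μ = ∫ U, f U ∂μ := by
  have hm : Measurable fun U : UN N => U * W := measurable_mul_const W
  have : IsProbabilityMeasure (Measure.map (· * W) μ) := Measure.isProbabilityMeasure_map hm.aemeasurable
  have h : Measure.map (· * W) μ = μ := Measure.isHaarMeasure_eq_of_isProbabilityMeasure _ _
  have e := (MeasurableEquiv.mulRight W).measurableEmbedding.integral_map (μ := μ) f
  conv_rhs => rw [← h]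
  exact e.symm

lemma bgwMoment_right (n : ℕ) (A B W : Matrix (Fin N) (Fin N) ℂ) (hW : Wᴴ * W = 1) :
    bgwMoment μ n (W * A) (B * Wᴴ) = bgwMoment μ n A B := by
  have hW' : W ∈ Matrix.unitaryGroup (Fin N) ℂ := Matrix.mem_unitaryGroup_iff'.2 hW
  rw [bgwMoment, bgwMoment]
  conv_rhs => rw [← integral_mul_right_UN μ _ ⟨W, hW'⟩]
  congr 1
  ext U
  simp only [Submonoid.coe_mul, Matrix.conjTranspose_mul]
  rw [Matrix.mul_assoc, ← Matrix.mul_assoc _ B, Matrix.trace_mul_comm (_ * B), ← Matrix.mul_assoc,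
    ← Matrix.mul_assoc]

lemma ClassFn.bgwMoment (n : ℕ) : ClassFn fun A => bgwMoment μ n A 1 := by
  refine ⟨Ent.bgwMoment_fst μ n 1, fun V X h => ?_⟩
  have h1 := bgwMoment_right μ n (X * Vᴴ) V V h
  rw [mul_eq_one_comm.1 h, ← Matrix.mul_assoc] at h1
  have h2 := bgwMoment_left μ n X 1 Vᴴ (by simpa using mul_eq_one_comm.1 h)
  rw [Matrix.mul_one, Matrix.conjTranspose_conjTranspose] at h2
  exact h1.trans h2

end haar

section schurSpan
variable {N : ℕ}

/-- The span of the Schur functions of partitions. -/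
def schurSpan (N : ℕ) : Submodule ℂ (Matrix (Fin N) (Fin N) ℂ → ℂ) :=
  Submodule.span ℂ (Set.range fun l : PartitionN N => fun A => schur l.1 A)

lemma eMat_mul_mem_schurSpan (r : ℕ) {f : Matrix (Fin N) (Fin N) ℂ → ℂ} (hf : f ∈ schurSpan N) :
    (fun A => eMat r A * f A) ∈ schurSpan N := by
  induction hf using Submodule.span_induction with
  | mem f hf =>
    obtain ⟨l, rfl⟩ := hf
    have : (fun A => eMat r A * schur l.1 A) =
        ∑ S ∈ (Finset.univ : Finset (Fin N)).powersetCard r, fun A => schur (addBoxes l.1 S) A := by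
      ext A; rw [← pieri, Finset.sum_apply]
    beta_reduce
    rw [this]
    refine Submodule.sum_mem _ fun S _ => ?_
    by_cases hS : Antitone (addBoxes l.1 S)
    · exact Submodule.subset_span ⟨⟨_, hS⟩, rfl⟩
    · have : (fun A : Matrix (Fin N) (Fin N) ℂ => schur (addBoxes l.1 S) A) = 0 := by
        ext A; exact schur_addBoxes_eq_zero l.2 hS A
      rw [this]; exact Submodule.zero_mem _
  | zero => simp only [Pi.zero_apply, mul_zero]; exact Submodule.zero_mem _
  | add f g _ _ hf hg =>
    simp only [Pi.add_apply, mul_add]; exact Submodule.add_mem _ hf hg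
  | smul c f _ hf =>
    have : (fun A => eMat r A * (c • f) A) = c • fun A => eMat r A * f A := by
      ext A; simp; ring
    rw [this]; exact Submodule.smul_mem _ _ hf

lemma aeval_eMat_mem_schurSpan {n : ℕ} (q : MvPolynomial (Fin n) ℂ) :
    (fun A : Matrix (Fin N) (Fin N) ℂ => MvPolynomial.eval (fun i : Fin n => eMat ((i : ℕ) + 1) A) q) ∈
      schurSpan N := by
  induction q using MvPolynomial.induction_on with
  | C c =>
    have : (fun A : Matrix (Fin N) (Fin N) ℂ =>
        MvPolynomial.eval (fun i : Fin n => eMat ((i : ℕ) + 1) A) (MvPolynomial.C c)) =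
        c • fun A => schur (fun _ => 0) A := by
      ext A; simp [schur_zero]
    rw [this]
    exact Submodule.smul_mem _ _ (Submodule.subset_span ⟨⟨_, antitone_const⟩, rfl⟩)
  | add p q hp hq => simp only [map_add]; exact Submodule.add_mem _ hp hq
  | mul_X p i hp =>
    simp only [map_mul, MvPolynomial.eval_X, mul_comm _ (eMat _ _)]
    exact eMat_mul_mem_schurSpan _ hp

lemma ClassFn.diagonal_perm {f : Matrix (Fin N) (Fin N) ℂ → ℂ} (hf : ClassFn f)
    (d : Fin N → ℂ) (σ : Equiv.Perm (Fin N)) : f (diagonal (d ∘ σ)) = f (diagonal d) := by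
  set V : Matrix (Fin N) (Fin N) ℂ := (1 : Matrix (Fin N) (Fin N) ℂ).submatrix σ id with hV
  have h1 : V * Vᴴ = 1 := by
    rw [hV, conjTranspose_submatrix, conjTranspose_one]
    rw [Matrix.submatrix_mul _ _ _ id _ Function.bijective_id |>.symm, Matrix.one_mul,
      Matrix.submatrix_one _ σ.injective]
  have h2 : V * diagonal d * Vᴴ = diagonal (d ∘ σ) := by
    rw [hV, conjTranspose_submatrix, conjTranspose_one]
    have : (diagonal d).submatrix id id = diagonal d := rfl
    rw [← this, ← Matrix.submatrix_mul _ _ _ id _ Function.bijective_id, Matrix.one_mul,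
      ← Matrix.submatrix_mul _ _ _ id _ Function.bijective_id, Matrix.mul_one,
      Matrix.submatrix_diagonal _ _ σ.injective]
  rw [← h2, hf.conj _ _ (mul_eq_one_comm.1 h1)]

lemma ClassFn.mem_schurSpan {f : Matrix (Fin N) (Fin N) ℂ → ℂ} (hf : ClassFn f)
    (p : MvPolynomial (Fin N) ℂ) (hp : ∀ d, f (diagonal d) = MvPolynomial.eval d p) :
    f ∈ schurSpan N := by
  have hs : p.IsSymmetric := by
    intro σ
    refine MvPolynomial.funext fun d => ?_
    rw [MvPolynomial.eval_rename, ← hp, ← hp, hf.diagonal_perm]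
  obtain ⟨q, hq⟩ := MvPolynomial.esymmAlgHom_surjective (n := N) (σ := Fin N) ℂ (by simp) ⟨p, hs⟩
  have hq' := congrArg Subtype.val hq
  rw [MvPolynomial.esymmAlgHom_apply] at hq'
  change _ = p at hq'
  have : f = fun A => MvPolynomial.eval (fun i : Fin N => _root_.eMat ((i : ℕ) + 1) A) q := by
    refine hf.eq ⟨?_, ?_⟩ fun d => ?_
    · simp only [MvPolynomial.eval_eq']
      exact Ent.sum _ fun a _ => (Ent.const _).mul
        (Ent.prod _ fun i _ => (ClassFn.eMat _).ent.pow _)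
    · intro V X h
      simp only [(ClassFn.eMat _).conj V X h]
    · rw [hp, ← hq', MvPolynomial.aeval_def, MvPolynomial.eval₂_eq', map_sum,
        MvPolynomial.eval_eq']
      simp [eMat_diagonal, MvPolynomial.esymm]
  rw [this]
  exact aeval_eMat_mem_schurSpan q

lemma schur_smul (l : Fin N → ℕ) (z : ℂ) (A : Matrix (Fin N) (Fin N) ℂ) :
    schur l (z • A) = z ^ wt l * schur l A := by
  rw [schur_eq_sum, schur_eq_sum, Finsupp.mul_sum]
  refine Finset.sum_congr rfl fun Z _ => ?_
  simp only [Matrix.mul_smul, Matrix.trace_smul, smul_eq_mul, mul_pow]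
  ring

lemma exists_eq_sum_parts {f : Matrix (Fin N) (Fin N) ℂ → ℂ} (hf : f ∈ schurSpan N) {n : ℕ}
    (hn : ∀ (z : ℂ) A, f (z • A) = z ^ n * f A) :
    ∃ c : (Fin N → ℕ) → ℂ, ∀ A, f A = ∑ l ∈ parts N n, c l * schur l A := by
  rw [schurSpan, Finsupp.mem_span_range_iff_exists_finsupp] at hf
  obtain ⟨c, hc⟩ := hf
  have hc' : ∀ A, f A = ∑ l ∈ c.support, c l * schur l.1 A := by
    intro A
    rw [← hc, Finsupp.sum, Finset.sum_apply]
    rfl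
  refine ⟨fun l => if h : Antitone l then c ⟨l, h⟩ else 0, fun A => ?_⟩
  have hpoly : (∑ l ∈ c.support, Polynomial.monomial (wt l.1) (c l * schur l.1 A)) =
      Polynomial.monomial n (f A) := by
    refine Polynomial.funext fun z => ?_
    rw [Polynomial.eval_finsetSum, Polynomial.eval_monomial, mul_comm, ← hn, hc']
    refine Finset.sum_congr rfl fun l _ => ?_
    rw [schur_smul, Polynomial.eval_monomial]
    ring
  have h := congrArg (fun p => Polynomial.coeff p n) hpoly
  simp only [Polynomial.finsetSum_coeff, Polynomial.coeff_monomial, if_true] at h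
  rw [← h, ← Finset.sum_filter]
  refine Finset.sum_bij_ne_zero (fun l _ _ => l.1) ?_ ?_ ?_ ?_
  · intro l hl _
    exact mem_parts.2 ⟨l.2, (Finset.mem_filter.1 hl).2⟩
  · intro l _ _ l' _ _ h
    exact Subtype.ext h
  · intro l hl hne
    obtain ⟨h1, h2⟩ := mem_parts.1 hl
    beta_reduce at hne
    rw [dif_pos h1] at hne
    refine ⟨⟨l, h1⟩, ?_, hne, rfl⟩
    exact Finset.mem_filter.2 ⟨Finsupp.mem_support_iff.2 (left_ne_zero_of_mul hne), h2⟩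
  · intro l _ _
    obtain ⟨l, hl⟩ := l
    beta_reduce
    rw [dif_pos hl]

end schurSpan

section moments
variable {N : ℕ} (μ : Measure (UN N)) [μ.IsHaarMeasure]

lemma bgwMoment_diagonal (n : ℕ) : ∃ p : MvPolynomial (Fin N) ℂ,
    ∀ d, bgwMoment μ n (diagonal d) 1 = MvPolynomial.eval d p := by
  refine ⟨∑ a ∈ Finset.piAntidiag (Finset.univ : Finset (Fin N)) n,
    MvPolynomial.monomial (Finsupp.equivFunOnFinite.symm a)
      (∫ U : UN N, (Nat.multinomial Finset.univ a : ℂ) *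
        (∏ i, (U : Matrix (Fin N) (Fin N) ℂ) i i ^ a i) *
        ((U : Matrix (Fin N) (Fin N) ℂ)ᴴ * 1).trace ^ n ∂μ), fun d => ?_⟩
  rw [map_sum]
  simp only [MvPolynomial.eval_monomial, ← integral_mul_const]
  rw [← integral_finsetSum, bgwMoment]
  · congr 1
    ext U
    have : ((U : Matrix (Fin N) (Fin N) ℂ) * diagonal d).trace =
        ∑ i, (U : Matrix (Fin N) (Fin N) ℂ) i i * d i := by
      simp [Matrix.trace, mul_diagonal]
    rw [this, Finset.sum_pow_eq_sum_piAntidiag, Finset.sum_mul]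
    refine Finset.sum_congr rfl fun a _ => ?_
    rw [Finsupp.prod_fintype _ _ (fun i => pow_zero _)]
    simp only [mul_pow, Finset.prod_mul_distrib, Finsupp.equivFunOnFinite_symm_apply_apply]
    ring
  · intro a _
    refine integrable_of_continuous μ ?_
    have h1 : ∀ i j, Continuous fun U : UN N => (U : Matrix (Fin N) (Fin N) ℂ) i j :=
      fun i j => continuous_coe_UN.matrix_elem i j
    have h2 := continuous_trace_star_mul (N := N) 1
    exact ((continuous_const.mul (continuous_finsetProd _ fun i _ => (h1 i i).pow _)).mul
      (h2.pow n)).mul continuous_const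

variable [IsProbabilityMeasure μ]

lemma exists_bgwMoment_eq_sum (n : ℕ) : ∃ c : (Fin N → ℕ) → ℂ, ∀ A B,
    bgwMoment μ n A B = ∑ l ∈ parts N n, c l * schur l (A * B) := by
  obtain ⟨p, hp⟩ := bgwMoment_diagonal μ n
  obtain ⟨c, hc⟩ := exists_eq_sum_parts ((ClassFn.bgwMoment μ n).mem_schurSpan p hp) (n := n) (by
    intro z A
    simp only [bgwMoment, ← integral_const_mul, Matrix.mul_smul, Matrix.trace_smul, smul_eq_mul,
      mul_pow, mul_assoc])
  refine ⟨c, fun A B => ?_⟩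
  refine (Ent.bgwMoment_snd μ n A).eq_of_unitary (Ent.sum _ fun l _ => (Ent.const _).mul
    ((Ent.schur l).comp (Ent.mulLeft A))) (fun W hW => ?_) B
  rw [← hc, ← bgwMoment_left μ n (A * W) 1 Wᴴ (by simpa using mul_eq_one_comm.1 hW)]
  rw [Matrix.mul_assoc, mul_eq_one_comm.1 hW, Matrix.mul_one, conjTranspose_conjTranspose,
    Matrix.mul_one]

end moments

section orthogonality
variable {N : ℕ}

lemma continuous_schur_comp (l : Fin N → ℕ) {φ : UN N → Matrix (Fin N) (Fin N) ℂ}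
    (hφ : Continuous φ) : Continuous fun U => schur l (φ U) := by
  simp only [schur_eq_sum, Finsupp.sum]
  exact continuous_finsetSum _ fun Z _ => continuous_const.mul
    ((continuous_const.matrix_mul hφ).matrix_trace.pow _)

lemma continuous_schur_UN (l : Fin N → ℕ) :
    Continuous fun U : UN N => schur l (U : Matrix (Fin N) (Fin N) ℂ) :=
  continuous_schur_comp l continuous_coe_UN

lemma continuous_schur_star_UN (l : Fin N → ℕ) :
    Continuous fun U : UN N => schur l (U : Matrix (Fin N) (Fin N) ℂ)ᴴ :=
  continuous_schur_comp l continuous_coe_UN.matrix_conjTranspose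

lemma schur_addBoxes_univ (l : Fin N → ℕ) (X : Matrix (Fin N) (Fin N) ℂ) :
    schur (addBoxes l Finset.univ) X = X.det * schur l X := by
  rw [← eMat_top, ← pieri]
  have : (Finset.univ : Finset (Fin N)).powersetCard N = {Finset.univ} := by
    have h := Finset.powersetCard_self (Finset.univ : Finset (Fin N))
    rwa [Finset.card_univ, Fintype.card_fin] at h
  rw [this, Finset.sum_singleton]

/-- The pairing of characters `∫ s_l(U) s_k(U†) dU`. -/
def charPair (μ : Measure (UN N)) (l k : Fin N → ℕ) : ℂ :=
  ∫ U : UN N, schur l (U : Matrix (Fin N) (Fin N) ℂ) *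
        schur k (U : Matrix (Fin N) (Fin N) ℂ)ᴴ ∂μ

lemma charPair_addBoxes_univ (μ : Measure (UN N)) (l : Fin N → ℕ) :
    charPair μ (addBoxes l Finset.univ) (addBoxes l Finset.univ) = charPair μ l l := by
  rw [charPair, charPair]
  congr 1
  ext U
  have hU : (U : Matrix (Fin N) (Fin N) ℂ).det * (U : Matrix (Fin N) (Fin N) ℂ)ᴴ.det = 1 := by
    rw [← Matrix.det_mul, ← star_eq_conjTranspose, Matrix.mem_unitaryGroup_iff.1 U.2,
      Matrix.det_one]
  rw [schur_addBoxes_univ, schur_addBoxes_univ]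
  linear_combination (schur l (U : Matrix (Fin N) (Fin N) ℂ) *
    schur l (U : Matrix (Fin N) (Fin N) ℂ)ᴴ) * hU

variable (μ : Measure (UN N)) [μ.IsHaarMeasure]

lemma integral_schur_mul_schur_eq_sum {l k : Fin N → ℕ} {n : ℕ} (hl : wt l = n) (hk : wt k = n)
    (A B : Matrix (Fin N) (Fin N) ℂ) :
    ∫ U : UN N, schur l ((U : Matrix (Fin N) (Fin N) ℂ) * A) *
        schur k ((U : Matrix (Fin N) (Fin N) ℂ)ᴴ * B) ∂μ =
      (schurCoeff l).sum fun Y c => c * (schurCoeff k).sum fun Z d =>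
        d * bgwMoment μ n (A * Y) (B * Z) := by
  have e : ∀ U : UN N, schur l ((U : Matrix (Fin N) (Fin N) ℂ) * A) *
      schur k ((U : Matrix (Fin N) (Fin N) ℂ)ᴴ * B) =
      ∑ Y ∈ (schurCoeff l).support, ∑ Z ∈ (schurCoeff k).support,
        schurCoeff l Y * schurCoeff k Z * (((U : Matrix (Fin N) (Fin N) ℂ) * (A * Y)).trace ^ n *
          ((U : Matrix (Fin N) (Fin N) ℂ)ᴴ * (B * Z)).trace ^ n) := by
    intro U
    rw [schur_eq_sum, schur_eq_sum, Finsupp.sum, Finsupp.sum, Finset.sum_mul_sum, hl, hk]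
    refine Finset.sum_congr rfl fun Y _ => Finset.sum_congr rfl fun Z _ => ?_
    rw [Matrix.trace_mul_comm Y, Matrix.trace_mul_comm Z, Matrix.mul_assoc, Matrix.mul_assoc]
    ring
  have hint : ∀ Y Z, Integrable (fun U : UN N => schurCoeff l Y * schurCoeff k Z *
      (((U : Matrix (Fin N) (Fin N) ℂ) * (A * Y)).trace ^ n *
          ((U : Matrix (Fin N) (Fin N) ℂ)ᴴ * (B * Z)).trace ^ n)) μ := fun Y Z =>
    integrable_of_continuous μ (continuous_const.mul
      (((continuous_trace_mul _).pow n).mul ((continuous_trace_star_mul _).pow n)))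
  simp only [e]
  rw [integral_finsetSum _ fun Y _ => integrable_finsetSum _ fun Z _ => hint Y Z, Finsupp.sum]
  refine Finset.sum_congr rfl fun Y _ => ?_
  rw [integral_finsetSum _ fun Z _ => hint Y Z, Finsupp.sum, Finset.mul_sum]
  refine Finset.sum_congr rfl fun Z _ => ?_
  rw [integral_const_mul, bgwMoment]
  ring

variable [IsProbabilityMeasure μ]

/-- Coefficients of the moments in the Schur basis. -/
def momentCoeff (n : ℕ) : (Fin N → ℕ) → ℂ := (exists_bgwMoment_eq_sum μ n).choose

lemma bgwMoment_eq_sum (n : ℕ) (A B : Matrix (Fin N) (Fin N) ℂ) :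
    bgwMoment μ n A B = ∑ l ∈ parts N n, momentCoeff μ n l * schur l (A * B) :=
  (exists_bgwMoment_eq_sum μ n).choose_spec A B

lemma integral_schur_mul_schur_eq_pair {l k : Fin N → ℕ} {n : ℕ} (hk : Antitone k)
    (hln : wt l = n) (hkn : wt k = n)
    (h0 : ((wt k).factorial : ℂ) * schurPInf k ≠ 0) (A B : Matrix (Fin N) (Fin N) ℂ) :
    ∫ U : UN N, schur l ((U : Matrix (Fin N) (Fin N) ℂ) * A) *
        schur k ((U : Matrix (Fin N) (Fin N) ℂ)ᴴ * B) ∂μ =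
      momentCoeff μ n k / ((wt k).factorial * schurPInf k) * schurPair k l (B * A) := by
  rw [integral_schur_mul_schur_eq_sum μ hln hkn]
  have e : ∀ Y, ((schurCoeff k).sum fun Z d => d * bgwMoment μ n (A * Y) (B * Z)) =
      momentCoeff μ n k / ((wt k).factorial * schurPInf k) * schur k (B * A * Y) := by
    intro Y
    simp only [bgwMoment_eq_sum, Finsupp.sum, Finset.mul_sum]
    rw [Finset.sum_comm, Finset.sum_eq_single k]
    · rw [Matrix.mul_assoc, schur_mul_comm, schur_eq_schurPair hk, schurPair, Finsupp.sum,
        ← mul_assoc, div_mul_cancel₀ _ h0, Finset.mul_sum]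
      refine Finset.sum_congr rfl fun Z _ => ?_
      rw [← Matrix.mul_assoc (A * Y)]
      ring
    · intro j hj hjk
      obtain ⟨h1, h2⟩ := mem_parts.1 hj
      have := schurPair_eq_zero h1 hk (h2.trans hkn.symm) hjk (A * Y * B)
      rw [schurPair, Finsupp.sum] at this
      rw [← mul_zero (momentCoeff μ n j), ← this, Finset.mul_sum]
      refine Finset.sum_congr rfl fun Z _ => ?_
      rw [← Matrix.mul_assoc (A * Y)]
      ring
    · intro h
      exact (h (mem_parts.2 ⟨hk, hkn⟩)).elim
  simp only [e]
  rw [schurPair, Finsupp.sum, Finsupp.sum, Finset.mul_sum]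
  exact Finset.sum_congr rfl fun Y _ => by ring

lemma schur_eq_zero_of_schurPInf {k : Fin N → ℕ} (hk : Antitone k)
    (h : ((wt k).factorial : ℂ) * schurPInf k = 0) (X : Matrix (Fin N) (Fin N) ℂ) :
    schur k X = 0 := by
  rw [schur_eq_schurPair hk, h, zero_mul]

lemma integral_schur_mul_schur_eq_zero {l k : Fin N → ℕ} (hl : Antitone l) (hk : Antitone k)
    (h : wt l = wt k) (hne : l ≠ k) (A B : Matrix (Fin N) (Fin N) ℂ) :
    ∫ U : UN N, schur l ((U : Matrix (Fin N) (Fin N) ℂ) * A) *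
        schur k ((U : Matrix (Fin N) (Fin N) ℂ)ᴴ * B) ∂μ = 0 := by
  by_cases h0 : ((wt k).factorial : ℂ) * schurPInf k = 0
  · simp [schur_eq_zero_of_schurPInf hk h0]
  · rw [integral_schur_mul_schur_eq_pair μ hk h rfl h0, schurPair_eq_zero hk hl h.symm hne.symm,
      mul_zero]

lemma charPair_eq_zero {l k : Fin N → ℕ} (hl : Antitone l) (hk : Antitone k)
    (h : wt l = wt k) (hne : l ≠ k) : charPair μ l k = 0 := by
  rw [charPair]
  simpa using integral_schur_mul_schur_eq_zero μ hl hk h hne 1 1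

lemma antitone_addBoxes_univ {l : Fin N → ℕ} (hl : Antitone l) :
    Antitone (addBoxes l Finset.univ) := by
  intro i j hij
  simpa [addBoxes] using hl hij

lemma charPair_addBoxes_singleton (hN : 1 ≤ N) {m : Fin N → ℕ} {i : Fin N} (hm : Antitone m)
    (hl : Antitone (addBoxes m {i})) :
    charPair μ (addBoxes m {i}) (addBoxes m {i}) = charPair μ m m := by
  have hint : ∀ a b : Fin N → ℕ, Integrable (fun U : UN N =>
      schur a (U : Matrix (Fin N) (Fin N) ℂ) * schur b (U : Matrix (Fin N) (Fin N) ℂ)ᴴ) μ :=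
    fun a b => integrable_of_continuous μ ((continuous_schur_UN a).mul (continuous_schur_star_UN b))
  have h1 : ∫ U : UN N, eMat 1 (U : Matrix (Fin N) (Fin N) ℂ) *
      schur m (U : Matrix (Fin N) (Fin N) ℂ) *
        schur (addBoxes m {i}) (U : Matrix (Fin N) (Fin N) ℂ)ᴴ ∂μ =
      charPair μ (addBoxes m {i}) (addBoxes m {i}) := by
    simp only [← pieri, Finset.sum_mul]
    rw [integral_finsetSum _ fun S _ => hint _ _, Finset.sum_eq_single {i}]
    · rfl
    · intro S hS hne
      by_cases hS' : Antitone (addBoxes m S)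
      · refine charPair_eq_zero μ hS' hl ?_ fun h => hne ?_
        · rw [wt_addBoxes, wt_addBoxes, (Finset.mem_powersetCard.1 hS).2, Finset.card_singleton]
        · ext j
          have := congrFun h j
          simp only [addBoxes] at this
          by_cases h1 : j ∈ S <;> by_cases h2 : j ∈ ({i} : Finset (Fin N)) <;> simp_all
      · simp [schur_addBoxes_eq_zero hm hS']
    · intro h
      exact (h (Finset.mem_powersetCard.2 ⟨Finset.subset_univ _, Finset.card_singleton i⟩)).elim
  have h2 : ∫ U : UN N, eMat 1 (U : Matrix (Fin N) (Fin N) ℂ) *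
      schur m (U : Matrix (Fin N) (Fin N) ℂ) *
        schur (addBoxes m {i}) (U : Matrix (Fin N) (Fin N) ℂ)ᴴ ∂μ =
      charPair μ (addBoxes m Finset.univ) (addBoxes m Finset.univ) := by
    have e : ∀ U : UN N, eMat 1 (U : Matrix (Fin N) (Fin N) ℂ) *
      schur m (U : Matrix (Fin N) (Fin N) ℂ) *
        schur (addBoxes m {i}) (U : Matrix (Fin N) (Fin N) ℂ)ᴴ =
        ∑ S ∈ (Finset.univ : Finset (Fin N)).powersetCard (N - 1),
          schur (addBoxes m Finset.univ) (U : Matrix (Fin N) (Fin N) ℂ) *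
            schur (addBoxes (addBoxes m {i}) S) (U : Matrix (Fin N) (Fin N) ℂ)ᴴ := by
      intro U
      rw [← Finset.mul_sum, pieri, schur_addBoxes_univ,
        eMat_one_unitary hN _ (Matrix.mem_unitaryGroup_iff'.1 U.2)]
      ring
    simp only [e]
    have he : addBoxes (addBoxes m {i}) (Finset.univ.erase i) = addBoxes m Finset.univ := by
      ext j
      by_cases h : j = i <;> simp [addBoxes, h]
    rw [integral_finsetSum _ fun S _ => hint _ _, Finset.sum_eq_single (Finset.univ.erase i)]
    · rw [he]; rfl
    · intro S hS hne
      by_cases hS' : Antitone (addBoxes (addBoxes m {i}) S)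
      · refine charPair_eq_zero μ (antitone_addBoxes_univ hm) hS' ?_ fun h => hne ?_
        · rw [← he, wt_addBoxes, wt_addBoxes (addBoxes m {i}), (Finset.mem_powersetCard.1 hS).2,
            Finset.card_erase_of_mem (Finset.mem_univ _), Finset.card_univ, Fintype.card_fin]
        · rw [← he] at h
          ext j
          have := congrFun h j
          simp only [addBoxes] at this
          by_cases h1 : j ∈ S <;> by_cases h2 : j ∈ Finset.univ.erase i <;> simp_all
      · simp [schur_addBoxes_eq_zero hl hS']
    · intro h
      refine (h (Finset.mem_powersetCard.2 ⟨Finset.subset_univ _, ?_⟩)).elim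
      rw [Finset.card_erase_of_mem (Finset.mem_univ _), Finset.card_univ, Fintype.card_fin]
  rw [← h1, h2, charPair_addBoxes_univ]

lemma exists_addBoxes_singleton {l : Fin N → ℕ} (hl : Antitone l) (h0 : wt l ≠ 0) :
    ∃ (m : Fin N → ℕ) (i : Fin N), Antitone m ∧ addBoxes m {i} = l := by
  have hne : (Finset.univ.filter fun i => l i ≠ 0).Nonempty := by
    rw [Finset.filter_nonempty_iff]
    by_contra h
    push Not at h
    exact h0 (Finset.sum_eq_zero h)
  obtain ⟨i, hi, hmax⟩ := Finset.exists_max_image _ id hne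
  have hi0 : l i ≠ 0 := (Finset.mem_filter.1 hi).2
  have hz : ∀ j, i < j → l j = 0 := by
    intro j hj
    by_contra h
    exact absurd (hmax j (Finset.mem_filter.2 ⟨Finset.mem_univ _, h⟩)) (not_le.2 hj)
  refine ⟨remBox l i, i, ?_, addBoxes_remBox (by omega)⟩
  intro a b hab
  have h1 := hl hab
  have h2 : i < b → l b = 0 := hz b
  simp only [remBox]
  by_cases ha : a = i <;> by_cases hb : b = i
  · simp [ha, hb]
  · have : l b = 0 := hz b (lt_of_le_of_ne (ha ▸ hab) (Ne.symm hb))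
    simp [this]
  · subst hb
    simp only [ha, if_true, if_false]
    omega
  · simpa [ha, hb] using h1

lemma charPair_self (hN : 1 ≤ N) {l : Fin N → ℕ} (hl : Antitone l) : charPair μ l l = 1 := by
  induction hn : wt l generalizing l with
  | zero =>
    have : l = fun _ => 0 := by
      ext i
      exact (Finset.sum_eq_zero_iff.1 hn) i (Finset.mem_univ i)
    subst this
    simp [charPair, schur_zero]
  | succ n ih =>
    obtain ⟨m, i, hm, rfl⟩ := exists_addBoxes_singleton hl (by omega)
    rw [charPair_addBoxes_singleton μ hN hm hl]
    refine ih hm ?_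
    rw [wt_addBoxes, Finset.card_singleton] at hn
    omega

lemma factorial_mul_schurPInf_ne_zero (μ : Measure (UN N)) [μ.IsHaarMeasure] [IsProbabilityMeasure μ]
    (hN : 1 ≤ N) {k : Fin N → ℕ} (hk : Antitone k) :
    ((wt k).factorial : ℂ) * schurPInf k ≠ 0 := by
  intro h
  have := charPair_self μ hN hk
  simp [charPair, schur_eq_zero_of_schurPInf hk h] at this

lemma momentCoeff_mul_schur_one (hN : 1 ≤ N) {k : Fin N → ℕ} (hk : Antitone k) :
    momentCoeff μ (wt k) k * schur k (1 : Matrix (Fin N) (Fin N) ℂ) =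
      ((wt k).factorial * schurPInf k) ^ 2 := by
  have h0 := factorial_mul_schurPInf_ne_zero μ hN hk
  have h1 := integral_schur_mul_schur_eq_pair μ (l := k) hk rfl rfl h0 1 1
  have h2 := charPair_self μ hN hk
  have h3 := schur_eq_schurPair hk (1 : Matrix (Fin N) (Fin N) ℂ)
  simp only [Matrix.mul_one] at h1
  rw [charPair, h1, div_mul_eq_mul_div, div_eq_iff h0, one_mul] at h2
  rw [h3]
  linear_combination ((wt k).factorial * schurPInf k) * h2

lemma schur_one_ne_zero (μ : Measure (UN N)) [μ.IsHaarMeasure] [IsProbabilityMeasure μ]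
    (hN : 1 ≤ N) {k : Fin N → ℕ} (hk : Antitone k) :
    schur k (1 : Matrix (Fin N) (Fin N) ℂ) ≠ 0 := by
  intro h
  have := momentCoeff_mul_schur_one μ hN hk
  rw [h, mul_zero] at this
  exact factorial_mul_schurPInf_ne_zero μ hN hk (pow_eq_zero_iff two_ne_zero |>.1 this.symm)

lemma integral_schur_mul_schur (hN : 1 ≤ N) {k : Fin N → ℕ} (hk : Antitone k)
    (A B : Matrix (Fin N) (Fin N) ℂ) :
    ∫ U : UN N, schur k ((U : Matrix (Fin N) (Fin N) ℂ) * A) *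
        schur k ((U : Matrix (Fin N) (Fin N) ℂ)ᴴ * B) ∂μ =
      schur k (A * B) / schur k (1 : Matrix (Fin N) (Fin N) ℂ) := by
  have h0 := factorial_mul_schurPInf_ne_zero μ hN hk
  have h1 := integral_schur_mul_schur_eq_pair μ (l := k) hk rfl rfl h0 A B
  have h3 := schur_eq_schurPair hk (B * A)
  have h4 := momentCoeff_mul_schur_one μ hN hk
  rw [h1, schur_mul_comm k A B, div_mul_eq_mul_div, div_eq_div_iff h0 (schur_one_ne_zero μ hN hk),
    h3]
  linear_combination schurPair k k (B * A) * h4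

lemma bgwMoment_eq (hN : 1 ≤ N) (n : ℕ) (A B : Matrix (Fin N) (Fin N) ℂ) :
    bgwMoment μ n A B = (n.factorial : ℂ) ^ 2 * ∑ l ∈ parts N n, schurPInf l ^ 2 *
      schur l (A * B) / schur l (1 : Matrix (Fin N) (Fin N) ℂ) := by
  rw [bgwMoment_eq_sum, Finset.mul_sum]
  refine Finset.sum_congr rfl fun l hl => ?_
  obtain ⟨h1, rfl⟩ := mem_parts.1 hl
  have h4 := momentCoeff_mul_schur_one μ hN h1
  rw [eq_comm, mul_div_assoc', div_eq_iff (schur_one_ne_zero μ hN h1)]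
  linear_combination (-schur l (A * B)) * h4

end orthogonality

section summability
variable {N : ℕ}

lemma hMat_conjTranspose (X : Matrix (Fin N) (Fin N) ℂ) (n : ℕ) :
    hMat Xᴴ n = star (hMat X n) := by
  induction n using Nat.strong_induction_on with
  | _ n ih =>
    cases n with
    | zero => simp [hMat_zero]
    | succ n =>
      rw [hMat_succ, hMat_succ, star_mul', star_sum]
      congr 1
      · simp
      · refine Finset.sum_congr rfl fun m hm => ?_
        rw [ih (n - m) (by omega), star_mul', ← Matrix.conjTranspose_pow,
          Matrix.trace_conjTranspose]

lemma schur_conjTranspose (l : Fin N → ℕ) (X : Matrix (Fin N) (Fin N) ℂ) :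
    schur l Xᴴ = star (schur l X) := by
  rw [schur, schur, ← Matrix.det_conjTranspose, ← Matrix.det_transpose]
  congr 1
  ext i j
  simp only [Matrix.transpose_apply, Matrix.of_apply, Matrix.conjTranspose_apply, hMatZ]
  split_ifs <;> simp [hMat_conjTranspose]

lemma star_schurPInf (l : Fin N → ℕ) : star (schurPInf l) = schurPInf l := by
  rw [schurPInf, ← Matrix.det_conjTranspose, ← Matrix.det_transpose]
  congr 1
  ext i j
  simp only [Matrix.transpose_apply, Matrix.of_apply, Matrix.conjTranspose_apply, factInvZ]
  split_ifs <;> simp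

lemma schurPInf_sq_eq_norm (l : Fin N → ℕ) : schurPInf l ^ 2 = ((‖schurPInf l‖ ^ 2 : ℝ) : ℂ) := by
  have h := Complex.mul_conj' (schurPInf l)
  rw [starRingEnd_apply, star_schurPInf] at h
  rw [sq, h, Complex.ofReal_pow]

/-- The fibre of the weight over `n` is the finite set of partitions of `n`. -/
def fiberEquivParts (n : ℕ) : {l : PartitionN N // wt l.1 = n} ≃ parts N n where
  toFun l := ⟨l.1.1, mem_parts.2 ⟨l.1.2, l.2⟩⟩
  invFun l := ⟨⟨l.1, (mem_parts.1 l.2).1⟩, (mem_parts.1 l.2).2⟩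
  left_inv _ := rfl
  right_inv _ := rfl

lemma hasSum_fiber {E : Type*} [AddCommMonoid E] [TopologicalSpace E] (f : (Fin N → ℕ) → E)
    (n : ℕ) : HasSum (fun l : {l : PartitionN N // wt l.1 = n} => f l.1.1)
      (∑ l ∈ parts N n, f l) := by
  rw [← (fiberEquivParts n).symm.hasSum_iff]
  exact (parts N n).hasSum f

lemma summable_of_summable_parts {f : (Fin N → ℕ) → ℝ} (hf : ∀ l, Antitone l → 0 ≤ f l)
    (h : Summable fun n => ∑ l ∈ parts N n, f l) : Summable fun l : PartitionN N => f l.1 := by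
  rw [← (Equiv.sigmaFiberEquiv fun l : PartitionN N => wt l.1).summable_iff]
  refine (summable_sigma_of_nonneg fun x => hf _ x.2.1.2).2 ⟨fun n => (hasSum_fiber f n).summable, ?_⟩
  convert h using 2 with n
  exact (hasSum_fiber f n).tsum_eq

lemma hasSum_parts {f : (Fin N → ℕ) → ℂ} (h : Summable fun l : PartitionN N => f l.1) :
    HasSum (fun n => ∑ l ∈ parts N n, f l) (∑' l : PartitionN N, f l.1) := by
  have e := (Equiv.sigmaFiberEquiv fun l : PartitionN N => wt l.1).hasSum_iff.2 h.hasSum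
  exact e.sigma fun n => hasSum_fiber f n

lemma exists_norm_trace_le {φ : UN N → ℂ} (hφ : Continuous φ) : ∃ C : ℝ, 0 ≤ C ∧ ∀ U, ‖φ U‖ ≤ C := by
  obtain ⟨C, hC⟩ := isCompact_univ.exists_bound_of_continuousOn hφ.continuousOn
  exact ⟨max C 0, le_max_right _ _, fun U => (hC U trivial).trans (le_max_left _ _)⟩

lemma summable_pow_div_factorial_sq (C : ℝ) (hC : 0 ≤ C) :
    Summable fun n : ℕ => C ^ n / (n.factorial : ℝ) ^ 2 := by
  refine Summable.of_nonneg_of_le (fun n => by positivity) (fun n => ?_)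
    (Real.summable_pow_div_factorial C)
  have : (1 : ℝ) ≤ n.factorial := by exact_mod_cast n.factorial_pos
  gcongr
  nlinarith

lemma norm_bgwMoment_le (μ : Measure (UN N)) [IsProbabilityMeasure μ]
    (A B : Matrix (Fin N) (Fin N) ℂ) :
    ∃ C : ℝ, 0 ≤ C ∧ ∀ n, ‖bgwMoment μ n A B‖ ≤ C ^ n := by
  obtain ⟨C, hC, h⟩ := exists_norm_trace_le (continuous_trace_mul A)
  obtain ⟨D, hD, h'⟩ := exists_norm_trace_le (continuous_trace_star_mul B)
  refine ⟨C * D, by positivity, fun n => ?_⟩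
  refine (norm_integral_le_of_norm_le_const (C := (C * D) ^ n) (.of_forall fun U => ?_)).trans ?_
  · rw [norm_mul, norm_pow, norm_pow, mul_pow]
    gcongr
    · exact h U
    · exact h' U
  · simp

variable (μ : Measure (UN N)) [μ.IsHaarMeasure] [IsProbabilityMeasure μ]

lemma integral_norm_schur_sq (hN : 1 ≤ N) {k : Fin N → ℕ} (hk : Antitone k)
    (A : Matrix (Fin N) (Fin N) ℂ) :
    ((∫ U : UN N, ‖schur k ((U : Matrix (Fin N) (Fin N) ℂ) * A)‖ ^ 2 ∂μ : ℝ) : ℂ) =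
      schur k (A * Aᴴ) / schur k (1 : Matrix (Fin N) (Fin N) ℂ) := by
  rw [← integral_schur_mul_schur μ hN hk, ← integral_complex_ofReal]
  congr 1
  ext U
  rw [schur_mul_comm k _ Aᴴ, ← Matrix.conjTranspose_mul, schur_conjTranspose, Complex.ofReal_pow]
  exact (Complex.mul_conj' _).symm

lemma summable_schur_self (hN : 1 ≤ N) (r : ℝ) (hr : 0 ≤ r) (A : Matrix (Fin N) (Fin N) ℂ) :
    Summable fun l : PartitionN N => r ^ wt l.1 * ‖schurPInf l.1‖ ^ 2 *
      ∫ U : UN N, ‖schur l.1 ((U : Matrix (Fin N) (Fin N) ℂ) * A)‖ ^ 2 ∂μ := by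
  refine summable_of_summable_parts (f := fun l => r ^ wt l * ‖schurPInf l‖ ^ 2 *
      ∫ U : UN N, ‖schur l ((U : Matrix (Fin N) (Fin N) ℂ) * A)‖ ^ 2 ∂μ)
    (fun l _ => mul_nonneg (by positivity) (integral_nonneg fun U => by positivity)) ?_
  obtain ⟨C, hC, h⟩ := norm_bgwMoment_le μ A Aᴴ
  refine Summable.of_norm_bounded (summable_pow_div_factorial_sq (r * C) (by positivity))
    fun n => ?_
  have hn : (n.factorial : ℂ) ≠ 0 := by exact_mod_cast n.factorial_ne_zero
  have e : ((∑ l ∈ parts N n, r ^ wt l * ‖schurPInf l‖ ^ 2 *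
      ∫ U : UN N, ‖schur l ((U : Matrix (Fin N) (Fin N) ℂ) * A)‖ ^ 2 ∂μ : ℝ) : ℂ) =
      (r : ℂ) ^ n * bgwMoment μ n A Aᴴ / (n.factorial : ℂ) ^ 2 := by
    rw [bgwMoment_eq μ hN, mul_left_comm, mul_div_cancel_left₀ _ (pow_ne_zero 2 hn),
      Finset.mul_sum, Complex.ofReal_sum]
    refine Finset.sum_congr rfl fun l hl => ?_
    obtain ⟨h1, rfl⟩ := mem_parts.1 hl
    rw [Complex.ofReal_mul, Complex.ofReal_mul, integral_norm_schur_sq μ hN h1,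
      ← schurPInf_sq_eq_norm, Complex.ofReal_pow]
    ring
  rw [← Complex.norm_real, e, norm_div, norm_mul, norm_pow, norm_pow, Complex.norm_real,
    Real.norm_of_nonneg hr, Complex.norm_natCast, mul_pow]
  gcongr
  exact h n

lemma summable_schur (μ : Measure (UN N)) [μ.IsHaarMeasure] [IsProbabilityMeasure μ]
    (hN : 1 ≤ N) (β : ℂ) (A B : Matrix (Fin N) (Fin N) ℂ) :
    Summable fun l : PartitionN N => β ^ (2 * wt l.1) * schurPInf l.1 ^ 2 *
      schur l.1 (A * B) / schur l.1 (1 : Matrix (Fin N) (Fin N) ℂ) := by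
  refine Summable.of_norm_bounded ((summable_schur_self μ hN (‖β‖ ^ 2) (by positivity) A).add
    (summable_schur_self μ hN (‖β‖ ^ 2) (by positivity) Bᴴ)) fun l => ?_
  obtain ⟨l, hl⟩ := l
  have hi : ∀ A : Matrix (Fin N) (Fin N) ℂ, Integrable (fun U : UN N =>
      ‖schur l ((U : Matrix (Fin N) (Fin N) ℂ) * A)‖ ^ 2) μ := fun A => by
    have hc : Continuous fun U : UN N => ‖schur l ((U : Matrix (Fin N) (Fin N) ℂ) * A)‖ ^ 2 :=
      ((continuous_schur_comp l (continuous_coe_UN.matrix_mul continuous_const)).norm).pow 2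
    exact hc.integrable_of_hasCompactSupport (HasCompactSupport.of_compactSpace _)
  rw [mul_div_assoc, ← integral_schur_mul_schur μ hN hl A B, norm_mul, norm_mul, norm_pow,
    norm_pow, ← mul_add, pow_mul, ← integral_add (hi A) (hi Bᴴ)]
  gcongr
  refine norm_integral_le_of_norm_le ((hi A).add (hi Bᴴ)) (.of_forall fun U => ?_)
  have e : ‖schur l ((U : Matrix (Fin N) (Fin N) ℂ)ᴴ * B)‖ =
      ‖schur l ((U : Matrix (Fin N) (Fin N) ℂ) * Bᴴ)‖ := by
    rw [schur_mul_comm l _ Bᴴ, ← norm_star, ← schur_conjTranspose, Matrix.conjTranspose_mul,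
      Matrix.conjTranspose_conjTranspose]
  rw [norm_mul, e]
  nlinarith [sq_nonneg (‖schur l ((U : Matrix (Fin N) (Fin N) ℂ) * A)‖ -
    ‖schur l ((U : Matrix (Fin N) (Fin N) ℂ) * Bᴴ)‖),
    norm_nonneg (schur l ((U : Matrix (Fin N) (Fin N) ℂ) * A)),
    norm_nonneg (schur l ((U : Matrix (Fin N) (Fin N) ℂ) * Bᴴ))]

end summability

section partition_function
variable {N : ℕ}

/-- The scalar unitary matrix `exp(iθ)`. -/
def phaseUN (N : ℕ) (θ : ℝ) : UN N :=
  ⟨Complex.exp (θ * Complex.I) • 1, by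
    rw [Matrix.mem_unitaryGroup_iff, star_smul, star_one, smul_mul_smul_comm, mul_one]
    have : Complex.exp (θ * Complex.I) * star (Complex.exp (θ * Complex.I)) = 1 := by
      have h := Complex.mul_conj' (Complex.exp (θ * Complex.I))
      rw [Complex.norm_exp_ofReal_mul_I] at h
      simpa using h
    rw [this, one_smul]⟩

variable (μ : Measure (UN N)) [μ.IsHaarMeasure]

lemma integral_trace_pow_mul_eq_zero {j k : ℕ} (h : j ≠ k) (A B : Matrix (Fin N) (Fin N) ℂ) :
    ∫ U : UN N, ((U : Matrix (Fin N) (Fin N) ℂ) * A).trace ^ j *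
      ((U : Matrix (Fin N) (Fin N) ℂ)ᴴ * B).trace ^ k ∂μ = 0 := by
  set θ : ℝ := Real.pi / ((j : ℝ) - k) with hθ
  have hjk : ((j : ℝ) - k) ≠ 0 := sub_ne_zero.2 (by exact_mod_cast h)
  have e := integral_mul_left_UN μ (fun U => ((U : Matrix (Fin N) (Fin N) ℂ) * A).trace ^ j *
      ((U : Matrix (Fin N) (Fin N) ℂ)ᴴ * B).trace ^ k) (phaseUN N θ)
  have hz : Complex.exp (θ * Complex.I) ^ j * star (Complex.exp (θ * Complex.I)) ^ k = -1 := by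
    rw [← starRingEnd_apply, ← Complex.exp_conj, ← Complex.exp_nat_mul, ← Complex.exp_nat_mul,
      ← Complex.exp_add, ← Complex.exp_pi_mul_I]
    congr 1
    have : (Real.pi : ℂ) = θ * ((j : ℂ) - k) := by
      rw [hθ]
      exact_mod_cast (div_mul_cancel₀ Real.pi hjk).symm
    rw [this, map_mul, Complex.conj_ofReal, Complex.conj_I]
    ring
  have e' : ∀ U : UN N, (((phaseUN N θ * U : UN N) : Matrix (Fin N) (Fin N) ℂ) * A).trace ^ j *
      (((phaseUN N θ * U : UN N) : Matrix (Fin N) (Fin N) ℂ)ᴴ * B).trace ^ k =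
      -(((U : Matrix (Fin N) (Fin N) ℂ) * A).trace ^ j *
        ((U : Matrix (Fin N) (Fin N) ℂ)ᴴ * B).trace ^ k) := by
    intro U
    have hU : ((phaseUN N θ * U : UN N) : Matrix (Fin N) (Fin N) ℂ) =
        Complex.exp (θ * Complex.I) • (U : Matrix (Fin N) (Fin N) ℂ) := by
      rw [Submonoid.coe_mul, phaseUN, Matrix.smul_mul, Matrix.one_mul]
    rw [hU, Matrix.conjTranspose_smul, Matrix.smul_mul, Matrix.smul_mul, Matrix.trace_smul,
      Matrix.trace_smul, smul_eq_mul, smul_eq_mul, mul_pow, mul_pow, mul_mul_mul_comm, hz]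
    ring
  simp only [e', integral_neg] at e
  exact self_eq_neg.1 e.symm

variable [IsProbabilityMeasure μ]

lemma hasSum_bgwMoment (β : ℂ) (A B : Matrix (Fin N) (Fin N) ℂ) :
    HasSum (fun n : ℕ => β ^ (2 * n) / (n.factorial : ℂ) ^ 2 * bgwMoment μ n A B)
      (∫ U : UN N, Complex.exp (β * (((U : Matrix (Fin N) (Fin N) ℂ) * A).trace +
        ((U : Matrix (Fin N) (Fin N) ℂ)ᴴ * B).trace)) ∂μ) := by
  set a : UN N → ℂ := fun U => ((U : Matrix (Fin N) (Fin N) ℂ) * A).trace with ha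
  set b : UN N → ℂ := fun U => ((U : Matrix (Fin N) (Fin N) ℂ)ᴴ * B).trace with hb
  have hca : Continuous a := continuous_trace_mul A
  have hcb : Continuous b := continuous_trace_star_mul B
  obtain ⟨C, hC, hCa⟩ := exists_norm_trace_le (continuous_const.mul hca : Continuous fun U => β * a U)
  obtain ⟨D, hD, hDb⟩ := exists_norm_trace_le (continuous_const.mul hcb : Continuous fun U => β * b U)
  set F : ℕ × ℕ → UN N → ℂ := fun p U => (β * a U) ^ p.1 / (p.1.factorial : ℂ) *
    ((β * b U) ^ p.2 / (p.2.factorial : ℂ)) with hF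
  have hFc : ∀ p, Continuous (F p) := fun p => by
    simp only [hF]
    fun_prop
  have hsum : HasSum (fun p => ∫ U, F p U ∂μ) (∫ U, ∑' p, F p U ∂μ) := by
    refine hasSum_integral_of_summable_integral_norm
      (fun p => integrable_of_continuous μ (hFc p)) ?_
    refine Summable.of_norm_bounded ((Real.summable_pow_div_factorial C).mul_of_nonneg
      (Real.summable_pow_div_factorial D) (fun n => by positivity) (fun n => by positivity))
      fun p => ?_
    refine (norm_integral_le_of_norm_le_const (C := C ^ p.1 / (p.1.factorial : ℝ) *
      (D ^ p.2 / (p.2.factorial : ℝ))) (.of_forall fun U => ?_)).trans (by simp)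
    rw [norm_norm]
    simp only [hF]
    rw [norm_mul, norm_div, norm_div, norm_pow, norm_pow, Complex.norm_natCast,
      Complex.norm_natCast]
    gcongr
    · exact hCa U
    · exact hDb U
  have hexp : ∀ U, ∑' p, F p U = Complex.exp (β * (a U + b U)) := by
    intro U
    have h1 : ∀ x : ℂ, ∑' n : ℕ, x ^ n / (n.factorial : ℂ) = Complex.exp x := fun x => by
      rw [Complex.exp_eq_exp_ℂ]
      exact (NormedSpace.expSeries_div_hasSum_exp x).tsum_eq
    have h2 : ∀ x : ℂ, Summable fun n : ℕ => ‖x ^ n / (n.factorial : ℂ)‖ := fun x => by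
      simpa using Real.summable_pow_div_factorial ‖x‖
    rw [mul_add, Complex.exp_add, ← h1, ← h1, tsum_mul_tsum_of_summable_norm (h2 _) (h2 _)]
  have hint : ∀ p : ℕ × ℕ, ∫ U, F p U ∂μ = β ^ p.1 / (p.1.factorial : ℂ) *
      (β ^ p.2 / (p.2.factorial : ℂ)) * ∫ U, a U ^ p.1 * b U ^ p.2 ∂μ := by
    intro p
    rw [← integral_const_mul]
    congr 1
    ext U
    simp only [hF, mul_pow]
    ring
  simp only [hexp] at hsum
  rw [← Function.Injective.hasSum_iff (g := fun n : ℕ => (n, n))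
    (fun m n h => congrArg Prod.fst h)] at hsum
  · convert hsum using 2 with n
    simp only [Function.comp, hint, bgwMoment, ha, hb]
    ring
  · rintro ⟨j, k⟩ hjk
    have : j ≠ k := fun h => hjk ⟨j, by rw [h]⟩
    rw [hint]
    simp only [ha, hb]
    rw [integral_trace_pow_mul_eq_zero μ this, mul_zero]

end partition_function

/-- The Brezin-Gross-Witten partition function:
`∫_{U(N)} exp(β Tr(UA + U†B)) d_*U
= Σ_{λ : ℓ(λ) ≤ N} β^{2|λ|} s_λ(p_∞)² s_λ(AB)/s_λ(I_N)`,
the sum converging absolutely. -/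
theorem statement17 {N : ℕ} (hN : 1 ≤ N) (β : ℂ)
    (A B : Matrix (Fin N) (Fin N) ℂ)
    (μ : Measure (UN N)) [μ.IsHaarMeasure] [IsProbabilityMeasure μ] :
    Summable (fun l : PartitionN N =>
      β ^ (2 * wt l.1) * (schurPInf l.1) ^ 2 *
        schur l.1 (A * B) / schur l.1 (1 : Matrix (Fin N) (Fin N) ℂ)) ∧
    (∫ U : UN N,
        Complex.exp (β * (((U : Matrix (Fin N) (Fin N) ℂ) * A).trace + (star (U : Matrix (Fin N) (Fin N) ℂ) * B).trace)) ∂μ) =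
      ∑' l : PartitionN N,
        β ^ (2 * wt l.1) * (schurPInf l.1) ^ 2 *
          schur l.1 (A * B) / schur l.1 (1 : Matrix (Fin N) (Fin N) ℂ) := by
  have hs := summable_schur μ hN β A B
  refine ⟨hs, (hasSum_bgwMoment μ β A B).unique ?_⟩
  convert hasSum_parts (f := fun l => β ^ (2 * wt l) * (schurPInf l) ^ 2 *
    schur l (A * B) / schur l (1 : Matrix (Fin N) (Fin N) ℂ)) hs using 2 with n
  have hn : (n.factorial : ℂ) ≠ 0 := by exact_mod_cast n.factorial_ne_zero
  rw [bgwMoment_eq μ hN, ← mul_assoc, div_mul_cancel₀ _ (pow_ne_zero 2 hn), Finset.mul_sum]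
  refine Finset.sum_congr rfl fun l hl => ?_
  rw [(mem_parts.1 hl).2]
  ring

end
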